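/- Let H be a nonempty graph with v_H ≥ 3, and let G be a nonempty graph satisfying m_2(G) < x*(H). Then there exist positive constants a, b, C and n_0 such that for all n ≥ n_0 and all p with C·n^{-1/m_2(G,H)} ≤ p ≤ n^{-1/m*(H)}, with probability at least 1 − 2^{−b·n^{v_H}·p^{e_H}}, every red-blue coloring of the H-edges E_H(G_{n,p}) that contains no blue copy of H contains at least a·n^{v_G}·(n^{v_H−2}·p^{e_H})^{e_G} H-covered red copies of G. -/

import Mathlib

open scoped Classical

namespace AsymRamsey

/-- The 2-density `d₂` of a graph with `v` vertices and `e` edges. -/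
noncomputable def d2 (v e : ℕ) : ℝ :=
  if e = 0 then 0 else if 3 ≤ v then ((e : ℝ) - 1) / ((v : ℝ) - 2) else 1 / 2

/-- `m₂(H)`: the maximum of `d₂` over all subgraphs of `H`. -/
noncomputable def m2 {V : Type*} [Fintype V] (H : SimpleGraph V) : ℝ :=
  sSup {x : ℝ | ∃ J : H.Subgraph, x = d2 J.verts.ncard J.edgeSet.ncard}

/-- The asymmetric 2-density `d₂(G, ·)` applied to a graph with `v` vertices and `e` edges. -/
noncomputable def d2a {V : Type*} [Fintype V] (G : SimpleGraph V) (v e : ℕ) : ℝ :=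
  if G.edgeSet.ncard = 0 ∨ e = 0 then 0 else (e : ℝ) / ((v : ℝ) - 2 + 1 / m2 G)

/-- `m₂(G,H)`: the maximum of `d₂(G,·)` over all subgraphs of `H`. -/
noncomputable def m2a {V W : Type*} [Fintype V] [Fintype W]
    (G : SimpleGraph V) (H : SimpleGraph W) : ℝ :=
  sSup {x : ℝ | ∃ J : H.Subgraph, x = d2a G J.verts.ncard J.edgeSet.ncard}

/-- `H` is balanced with respect to `d₂(G,·)`. -/
def BalancedW {V W : Type*} [Fintype V] [Fintype W]
    (G : SimpleGraph V) (H : SimpleGraph W) : Prop :=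
  m2a G H = d2a G (Fintype.card W) H.edgeSet.ncard

/-- `H` is strictly balanced with respect to `d₂(G,·)`. -/
def StrictlyBalancedW {V W : Type*} [Fintype V] [Fintype W]
    (G : SimpleGraph V) (H : SimpleGraph W) : Prop :=
  BalancedW G H ∧
    ∀ J : H.Subgraph, J ≠ ⊤ → d2a G J.verts.ncard J.edgeSet.ncard < m2a G H

/-- `m*(H) = min {(e_H - e_J)/(v_H - v_J) : J ⊆ H, 2 ≤ v_J < v_H}`. -/
noncomputable def mStar {W : Type*} [Fintype W] (H : SimpleGraph W) : ℝ :=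
  sInf {x : ℝ | ∃ J : H.Subgraph, 2 ≤ J.verts.ncard ∧ J.verts.ncard < Fintype.card W ∧
    x = ((H.edgeSet.ncard : ℝ) - (J.edgeSet.ncard : ℝ)) /
        ((Fintype.card W : ℝ) - (J.verts.ncard : ℝ))}

/-- `x*(H) = m*(H) / (e_H - m*(H)(v_H - 2))`. -/
noncomputable def xStar {W : Type*} [Fintype W] (H : SimpleGraph W) : ℝ :=
  mStar H / ((H.edgeSet.ncard : ℝ) - mStar H * ((Fintype.card W : ℝ) - 2))

/-- A graph is a matching if it has maximum degree at most 1. -/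
def IsMatchingGraph {V : Type*} (G : SimpleGraph V) : Prop :=
  ∀ v : V, (G.neighborSet v).ncard ≤ 1

/-- `f` is (the embedding of) a copy of `H` in `F`. -/
def IsCopy {W V : Type*} (H : SimpleGraph W) (F : SimpleGraph V) (f : W ↪ V) : Prop :=
  ∀ ⦃u v : W⦄, H.Adj u v → F.Adj (f u) (f v)

/-- The edges of the copy of `H` given by the embedding `f`. -/
def copyEdges {W V : Type*} (H : SimpleGraph W) (f : W ↪ V) : Set (Sym2 V) :=
  Sym2.map (⇑f) '' H.edgeSet

/-- `E_H(F)`: the union of the edge sets of all copies of `H` in `F` (the `H`-edges of `F`). -/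
def HEdges {W V : Type*} (H : SimpleGraph W) (F : SimpleGraph V) : Set (Sym2 V) :=
  ⋃ f ∈ {f : W ↪ V | IsCopy H F f}, copyEdges H f

/-- `F → (G,H)`: every red-blue (true/false) coloring of the edges of `F` yields a
red copy of `G` or a blue copy of `H`. -/
def Arrows {α β γ : Type*} (F : SimpleGraph α) (G : SimpleGraph β) (H : SimpleGraph γ) : Prop :=
  ∀ c : Sym2 α → Bool,
    (∃ f : β ↪ α, IsCopy G F f ∧ ∀ e ∈ G.edgeSet, c (Sym2.map (⇑f) e) = true) ∨
    (∃ f : γ ↪ α, IsCopy H F f ∧ ∀ e ∈ H.edgeSet, c (Sym2.map (⇑f) e) = false)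

/-- `F` is Ramsey-critical for the pair `(G,H)`. -/
def Critical {α β γ : Type*} (F : SimpleGraph α) (G : SimpleGraph β) (H : SimpleGraph γ) : Prop :=
  Arrows F G H ∧ ∀ F' : F.Subgraph, F' ≠ ⊤ → ¬ Arrows F'.coe G H

/-- The probability that the binomial random graph `G_{n,p}` satisfies property `A`. -/
noncomputable def gnpProb (n : ℕ) (p : ℝ) (A : SimpleGraph (Fin n) → Prop) : ℝ :=
  ∑ S ∈ (Finset.univ.filter fun e : Sym2 (Fin n) => ¬ e.IsDiag).powerset,
    if A (SimpleGraph.fromEdgeSet (↑S)) then p ^ S.card * (1 - p) ^ (n.choose 2 - S.card) else 0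

/-- The edges of `F` induced on a vertex set `V`. -/
def EdgesIn {n : ℕ} (F : SimpleGraph (Fin n)) (V : Finset (Fin n)) : Set (Sym2 (Fin n)) :=
  {e ∈ F.edgeSet | ∀ v ∈ e, v ∈ V}

/-- `F` is `(ρ,d)`-dense. -/
def RhoDDense (n : ℕ) (ρ d : ℝ) (F : SimpleGraph (Fin n)) : Prop :=
  ∀ V : Finset (Fin n), ρ * (n : ℝ) ≤ (V.card : ℝ) →
    d * (n.choose 2 : ℝ) ≤ ((EdgesIn F V).ncard : ℝ)

/-- The general density measure `d_{a,b}`. -/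
noncomputable def dab (a b : ℝ) (v e : ℕ) : ℝ :=
  if e = 0 then 0 else ((e : ℝ) - a) / ((v : ℝ) - b)

/-- `m_{a,b}(H)`: the maximum of `d_{a,b}` over all subgraphs of `H`. -/
noncomputable def mab {W : Type*} [Fintype W] (a b : ℝ) (H : SimpleGraph W) : ℝ :=
  sSup {x : ℝ | ∃ J : H.Subgraph, x = dab a b J.verts.ncard J.edgeSet.ncard}

/-- `H` is balanced with respect to `d_{a,b}`. -/
def BalancedAB {W : Type*} [Fintype W] (a b : ℝ) (H : SimpleGraph W) : Prop :=
  mab a b H = dab a b (Fintype.card W) H.edgeSet.ncard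

/-- `H` is strictly balanced with respect to `d_{a,b}`. -/
def StrictlyBalancedAB {W : Type*} [Fintype W] (a b : ℝ) (H : SimpleGraph W) : Prop :=
  BalancedAB a b H ∧
    ∀ J : H.Subgraph, J ≠ ⊤ → dab a b J.verts.ncard J.edgeSet.ncard < mab a b H


universe u₁ u₂ u₃ u₄

section Containers

/-- The number of members of `𝓦` that agree with `ψ` on the coordinates in `S`. -/
noncomputable def codeg {ι X γ : Type*} (x : γ → ι → X) (𝓦 : Finset γ) (S : Finset ι)
    (ψ : ι → X) : ℕ :=
  (𝓦.filter fun g => ∀ i ∈ S, x g i = ψ i).card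

/-- All codegrees of `𝓦` in the coordinates `Q` are bounded by `D * θ ^ (|S| - 1)`. -/
def CodegLE {ι X γ : Type*} (x : γ → ι → X) (𝓦 : Finset γ) (Q : Finset ι) (θ D : ℝ) : Prop :=
  ∀ S ⊆ Q, S.Nonempty → ∀ ψ : ι → X, (codeg x 𝓦 S ψ : ℝ) ≤ D * θ ^ (S.card - 1)

theorem CodegLE.mono {ι X γ : Type*} {x : γ → ι → X} {𝓦 𝓥 : Finset γ} {Q : Finset ι} {θ D : ℝ}
    (h : CodegLE x 𝓦 Q θ D) (hsub : 𝓥 ⊆ 𝓦) : CodegLE x 𝓥 Q θ D := by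
  intro S hS hSne ψ
  refine le_trans ?_ (h S hS hSne ψ)
  unfold codeg
  exact_mod_cast Finset.card_le_card (Finset.filter_subset_filter _ hsub)

/-- `𝓥` witnesses that the set `Y` may be used as a fingerprint in coordinate `i`. -/
structure Feasible {ι X γ : Type*} (x : γ → ι → X) (𝓦 : Finset γ) (Q : Finset ι) (i : ι)
    (θ D' β : ℝ) (Y : Finset X) (𝓥 : Finset γ) : Prop where
  subset : 𝓥 ⊆ 𝓦
  mem : ∀ g ∈ 𝓥, x g i ∈ Y
  codegLE : CodegLE x 𝓥 (Q.erase i) θ D'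
  le_card : ∀ y ∈ Y, β ≤ ((𝓥.filter fun g => x g i = y).card : ℝ)

/-- The members of `𝓦` all of whose restrictions have codegree in `𝓥` at most half the cap. -/
noncomputable def unsaturated {ι X γ : Type*} (x : γ → ι → X) (𝓦 𝓥 : Finset γ) (Q : Finset ι)
    (i : ι) (θ D' : ℝ) : Finset γ :=
  𝓦.filter fun g => ∀ S ⊆ Q.erase i, S.Nonempty →
    (codeg x 𝓥 S (x g) : ℝ) ≤ D' / 2 * θ ^ (S.card - 1)

/-- The possible values of coordinate `i` that are taken by many unsaturated members of `𝓦`. -/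
noncomputable def heavy {ι X γ : Type*} [Fintype X] (x : γ → ι → X) (𝓦 𝓥 : Finset γ)
    (Q : Finset ι) (i : ι) (θ D' β : ℝ) : Finset X :=
  Finset.univ.filter fun y =>
    β ≤ (((unsaturated x 𝓦 𝓥 Q i θ D').filter fun g => x g i = y).card : ℝ)

theorem feasible_insert {ι X γ : Type*} {x : γ → ι → X} {𝓦 : Finset γ} {Q : Finset ι}
    {i : ι} {θ D D' β : ℝ} {Y : Finset X} {𝓥 : Finset γ} (hF : Feasible x 𝓦 Q i θ D' β Y 𝓥)
    (hi : i ∈ Q) (hθ : 0 < θ) (hD : CodegLE x 𝓦 Q θ D) (hDD' : D * θ ≤ D' / 2)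
    {y : X} (hy : β ≤ (((unsaturated x 𝓦 𝓥 Q i θ D').filter fun g => x g i = y).card : ℝ)) :
    Feasible x 𝓦 Q i θ D' β (insert y Y)
      (𝓥 ∪ (unsaturated x 𝓦 𝓥 Q i θ D').filter fun g => x g i = y) := by
  refine ⟨?_, ?_, ?_, ?_⟩
  · refine Finset.union_subset hF.subset ?_
    exact (Finset.filter_subset _ _).trans (Finset.filter_subset _ _)
  · intro g hg
    rcases Finset.mem_union.1 hg with hg | hg
    · exact Finset.mem_insert_of_mem (hF.mem g hg)
    · rw [(Finset.mem_filter.1 hg).2]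
      exact Finset.mem_insert_self _ _
  · intro S hS hSne ψ
    have hpow : 0 ≤ θ ^ (S.card - 1) := by positivity
    set A := (unsaturated x 𝓦 𝓥 Q i θ D').filter fun g => x g i = y with hA
    by_cases hex : ∃ g ∈ A, ∀ j ∈ S, x g j = ψ j
    · obtain ⟨g₀, hg₀, hψ⟩ := hex
      have h1 : (codeg x 𝓥 S ψ : ℝ) ≤ D' / 2 * θ ^ (S.card - 1) := by
        have := (Finset.mem_filter.1 (Finset.mem_filter.1 hg₀).1).2 S hS hSne
        convert this using 2
        unfold codeg
        congr 1
        refine Finset.filter_congr fun g _ => ?_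
        exact forall₂_congr fun j hj => by rw [hψ j hj]
      have h2 : (codeg x A S ψ : ℝ) ≤ D * θ ^ S.card := by
        have hiS : i ∉ S := fun h => by simpa using hS h
        have := hD (insert i S) (Finset.insert_subset hi (hS.trans (Finset.erase_subset _ _)))
          (Finset.insert_nonempty _ _) (Function.update ψ i y)
        rw [Finset.card_insert_of_notMem hiS, Nat.add_sub_cancel] at this
        refine le_trans ?_ this
        unfold codeg
        norm_cast
        refine Finset.card_le_card fun g hg => ?_
        rw [Finset.mem_filter] at hg ⊢
        obtain ⟨hgA, hg⟩ := hg
        rw [hA, Finset.mem_filter] at hgA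
        refine ⟨(Finset.filter_subset _ _) hgA.1, fun j hj => ?_⟩
        rcases Finset.mem_insert.1 hj with rfl | hj
        · simp [hgA.2]
        · have : j ≠ i := fun h => hiS (h ▸ hj)
          simp [this, hg j hj]
      have h3 : (codeg x (𝓥 ∪ A) S ψ : ℝ) ≤ codeg x 𝓥 S ψ + codeg x A S ψ := by
        unfold codeg
        rw [Finset.filter_union]
        exact_mod_cast Finset.card_union_le _ _
      have h4 : θ ^ S.card = θ * θ ^ (S.card - 1) := by
        rw [← pow_succ', Nat.sub_add_cancel hSne.card_pos]
      rw [h4] at h2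
      nlinarith
    · push Not at hex
      have : codeg x (𝓥 ∪ A) S ψ = codeg x 𝓥 S ψ := by
        unfold codeg
        rw [Finset.filter_union, Finset.union_eq_left.2]
        intro g hg
        rw [Finset.mem_filter] at hg
        obtain ⟨j, hj, hne⟩ := hex g hg.1
        exact absurd (hg.2 j hj) hne
      rw [this]
      exact hF.codegLE S hS hSne ψ
  · intro y' hy'
    rcases Finset.mem_insert.1 hy' with rfl | hy'
    · refine hy.trans ?_
      norm_cast
      refine Finset.card_le_card fun g hg => ?_
      rw [Finset.mem_filter, Finset.mem_union]
      exact ⟨Or.inr hg, (Finset.mem_filter.1 hg).2⟩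
    · refine (hF.le_card y' hy').trans ?_
      norm_cast
      exact Finset.card_le_card (Finset.filter_subset_filter _ Finset.subset_union_left)

theorem CodegLE.card_fiber_le {ι X γ : Type*} {x : γ → ι → X} {𝓦 : Finset γ} {Q : Finset ι}
    {θ D : ℝ} (hD : CodegLE x 𝓦 Q θ D) {i : ι} (hi : i ∈ Q) (y : X) :
    ((𝓦.filter fun g => x g i = y).card : ℝ) ≤ D := by
  simpa [codeg] using hD {i} (by simpa using hi) (by simp) fun _ => y

/-- Members of `𝓦` saturated on a fixed set of coordinates are few. -/
theorem card_saturated_le {ι X γ : Type*} {x : γ → ι → X} {𝓦 𝓥 : Finset γ} {Q S : Finset ι}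
    {θ D τ : ℝ} (hD : CodegLE x 𝓦 Q θ D) (hS : S ⊆ Q) (hSne : S.Nonempty) :
    ((𝓦.filter fun g => τ < (codeg x 𝓥 S (x g) : ℝ)).card : ℝ) * τ ≤
      𝓥.card * (D * θ ^ (S.card - 1)) := by
  set A := 𝓦.filter fun g => τ < (codeg x 𝓥 S (x g) : ℝ) with hA
  calc (A.card : ℝ) * τ = ∑ g ∈ A, τ := by simp
    _ ≤ ∑ g ∈ A, (codeg x 𝓥 S (x g) : ℝ) :=
        Finset.sum_le_sum fun g hg => (Finset.mem_filter.1 hg).2.le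
    _ ≤ ∑ g ∈ 𝓦, (codeg x 𝓥 S (x g) : ℝ) :=
        Finset.sum_le_sum_of_subset_of_nonneg (Finset.filter_subset _ _)
          fun _ _ _ => Nat.cast_nonneg _
    _ = ∑ g' ∈ 𝓥, (codeg x 𝓦 S (x g') : ℝ) := by
        simp only [codeg, Finset.card_filter, Nat.cast_sum]
        rw [Finset.sum_comm]
        refine Finset.sum_congr rfl fun g' _ => Finset.sum_congr rfl fun g _ => ?_
        simp only [eq_comm]
    _ ≤ ∑ g' ∈ 𝓥, D * θ ^ (S.card - 1) := Finset.sum_le_sum fun g' _ => hD S hS hSne _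
    _ = _ := by simp

theorem le_card_heavy {ι X γ : Type*} [Fintype X] {x : γ → ι → X} {𝓦 𝓥 : Finset γ}
    {Q : Finset ι} {i : ι} {θ N w ε κ κ' : ℝ} (hi : i ∈ Q) (hθ : 0 < θ) (hN : 0 < N)
    (hw : 0 < w) (hε : 0 < ε) (hκ : 0 < κ) (hκ' : 2 ^ (Q.card - 1) * 8 * κ ^ 2 / ε ≤ κ')
    (hX : (Fintype.card X : ℝ) ≤ N) (h𝓦 : ε * w ≤ 𝓦.card)
    (hD : CodegLE x 𝓦 Q θ (κ * w / N)) (h𝓥 : (𝓥.card : ℝ) ≤ κ * θ * w) :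
    ε / (2 * κ) * N ≤
      (heavy x 𝓦 𝓥 Q i θ (κ' * (θ * w) / N) (ε * w / (4 * N))).card := by
  have hκ'0 : 0 < κ' := lt_of_lt_of_le (by positivity) hκ'
  set D' := κ' * (θ * w) / N with hD'
  set β := ε * w / (4 * N) with hβ
  set U := heavy x 𝓦 𝓥 Q i θ D' β with hU
  set A := unsaturated x 𝓦 𝓥 Q i θ D' with hA
  have hsat : ((𝓦 \ A).card : ℝ) ≤ ε * w / 4 := by
    have hsub : 𝓦 \ A ⊆ (Q.erase i).powerset.biUnion fun S =>
        if S.Nonempty then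
          𝓦.filter fun g => D' / 2 * θ ^ (S.card - 1) < (codeg x 𝓥 S (x g) : ℝ) else ∅ := by
      intro g hg
      simp only [hA, unsaturated, Finset.mem_sdiff, Finset.mem_filter, not_and, not_forall,
        not_le] at hg
      obtain ⟨hg, h⟩ := hg
      obtain ⟨S, hS, hne, h⟩ := h hg
      simp only [Finset.mem_biUnion, Finset.mem_powerset]
      exact ⟨S, hS, by simp [hne, hg, h]⟩
    have hone : ∀ S ∈ (Q.erase i).powerset, (((if S.Nonempty then
        𝓦.filter fun g => D' / 2 * θ ^ (S.card - 1) < (codeg x 𝓥 S (x g) : ℝ)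
          else ∅ : Finset γ).card : ℕ) : ℝ) ≤ 2 * κ ^ 2 * w / κ' := by
      intro S hS
      split_ifs with hne
      · have h := card_saturated_le (𝓥 := 𝓥) (τ := D' / 2 * θ ^ (S.card - 1)) hD
          ((Finset.mem_powerset.1 hS).trans (Finset.erase_subset _ _)) hne
        have hp : 0 < θ ^ (S.card - 1) := by positivity
        rw [le_div_iff₀ hκ'0]
        have h' : ((𝓦.filter fun g => D' / 2 * θ ^ (S.card - 1) <
            (codeg x 𝓥 S (x g) : ℝ)).card : ℝ) * D' / 2 ≤ 𝓥.card * (κ * w / N) := by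
          refine le_of_mul_le_mul_right ?_ hp
          linarith
        have h'' : (𝓥.card : ℝ) * (κ * w / N) ≤ (κ * θ * w) * (κ * w / N) :=
          mul_le_mul_of_nonneg_right h𝓥 (by positivity)
        have h3 := h'.trans h''
        rw [hD'] at h3
        have hpos : 0 < θ * w / (2 * N) := by positivity
        refine le_of_mul_le_mul_right ?_ hpos
        calc _ = _ := ?_
          _ ≤ _ := h3
          _ = _ := ?_
        · rw [← hD', hD']
          field_simp
        · field_simp
      · simp only [Finset.card_empty, Nat.cast_zero]
        positivity
    have hpc : ((Q.erase i).powerset.card : ℝ) = 2 ^ (Q.card - 1) := by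
      rw [Finset.card_powerset, Finset.card_erase_of_mem hi]
      norm_cast
    have hle := Nat.cast_le (α := ℝ).2 ((Finset.card_le_card hsub).trans Finset.card_biUnion_le)
    rw [Nat.cast_sum] at hle
    calc ((𝓦 \ A).card : ℝ) ≤ ∑ S ∈ (Q.erase i).powerset, 2 * κ ^ 2 * w / κ' :=
          hle.trans (Finset.sum_le_sum hone)
      _ = 2 ^ (Q.card - 1) * (2 * κ ^ 2 * w / κ') := by
          rw [Finset.sum_const, nsmul_eq_mul, hpc]
      _ ≤ ε * w / 4 := by
          rw [div_le_iff₀ hε] at hκ'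
          rw [← mul_div_assoc, div_le_iff₀ hκ'0]
          nlinarith
  have hAcard : (𝓦.card : ℝ) ≤ A.card + (𝓦 \ A).card := by
    have := Finset.card_le_card (show 𝓦 ⊆ A ∪ (𝓦 \ A) by
      intro g hg; by_cases h : g ∈ A <;> simp [h, hg])
    exact_mod_cast this.trans (Finset.card_union_le _ _)
  have hAsum : (A.card : ℝ) = ∑ y : X, ((A.filter fun g => x g i = y).card : ℝ) := by
    rw [Finset.card_eq_sum_card_fiberwise (f := fun g => x g i) (t := Finset.univ)
      (fun _ _ => Finset.mem_coe.2 (Finset.mem_univ _))]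
    push_cast
    rfl
  have hyb : ∀ y : X, ((A.filter fun g => x g i = y).card : ℝ) ≤
      β + if y ∈ U then κ * w / N else 0 := by
    intro y
    have hβ0 : 0 ≤ β := by positivity
    split_ifs with hy
    · refine le_trans ?_ (le_add_of_nonneg_left hβ0)
      refine le_trans ?_ (hD.card_fiber_le hi y)
      exact_mod_cast Finset.card_le_card
        (Finset.filter_subset_filter _ (Finset.filter_subset _ _))
    · have : ¬ β ≤ ((A.filter fun g => x g i = y).card : ℝ) := fun h =>
        hy (by simp only [hU, heavy, Finset.mem_filter, Finset.mem_univ, true_and]; exact h)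
      linarith
  have hAle : (A.card : ℝ) ≤ ε * w / 4 + U.card * (κ * w / N) := by
    rw [hAsum]
    refine (Finset.sum_le_sum fun y _ => hyb y).trans ?_
    rw [Finset.sum_add_distrib, Finset.sum_ite_mem]
    simp only [Finset.sum_const, nsmul_eq_mul, Finset.univ_inter, Finset.card_univ]
    have : (Fintype.card X : ℝ) * β ≤ N * β :=
      mul_le_mul_of_nonneg_right hX (by positivity)
    have h2 : N * β = ε * w / 4 := by rw [hβ]; field_simp
    linarith
  have hfin : ε * w / 2 ≤ U.card * (κ * w / N) := by linarith
  have h3 : 0 < κ * w / N := by positivity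
  refine le_of_mul_le_mul_right ?_ h3
  refine le_trans (le_of_eq ?_) hfin
  field_simp


/-- `z.1` extends the conflict-free set `P` inside `I` so that every member of `I` rooted in `z.2`
conflicts with a chosen one. -/
structure Captures {X Ω : Type*} (root : Ω → X) (conf : Ω → Ω → Prop) (I P : Finset Ω)
    (z : Finset Ω × Finset X) : Prop where
  subset : z.1 ⊆ I
  disjoint : Disjoint P z.1
  pairwise : ((P ∪ z.1 : Finset Ω) : Set Ω).Pairwise fun ω ω' => ¬ conf ω ω'
  conflict : ∀ ω ∈ I, root ω ∈ z.2 → ∃ υ ∈ P ∪ z.1, conf ω υ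

/-- Every conflict-free subset of `I` spans few members of `𝓦`. -/
def SpansFew {ι X Ω γ : Type*} (x : γ → ι → X) (root : Ω → X) (conf : Ω → Ω → Prop)
    (𝓦 : Finset γ) (I : Finset Ω) (M : ℝ) : Prop :=
  ∀ T ⊆ I, ((T : Finset Ω) : Set Ω).Pairwise (fun ω ω' => ¬ conf ω ω') →
    ((𝓦.filter fun g => ∀ i, x g i ∈ T.image root).card : ℝ) < M

theorem SpansFew.mono {ι X Ω γ : Type*} {x : γ → ι → X} {root : Ω → X} {conf : Ω → Ω → Prop}
    {𝓦 𝓥 : Finset γ} {I : Finset Ω} {M : ℝ} (h : SpansFew x root conf 𝓦 I M) (hsub : 𝓥 ⊆ 𝓦) :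
    SpansFew x root conf 𝓥 I M := fun T hT hpair =>
  lt_of_le_of_lt
    (by exact_mod_cast Finset.card_le_card (Finset.filter_subset_filter _ hsub)) (h T hT hpair)

/-- The generating sum of the sets with at most `b` elements. -/
noncomputable def smallSetSum (Ω : Type*) [Fintype Ω] (t : ℝ) (b : ℕ) : ℝ :=
  ∑ T ∈ (Finset.univ : Finset (Finset Ω)).filter (fun T => T.card ≤ b), t ^ T.card

theorem one_le_smallSetSum (Ω : Type*) [Fintype Ω] {t : ℝ} (ht : 0 ≤ t) (b : ℕ) :
    1 ≤ smallSetSum Ω t b := by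
  unfold smallSetSum
  refine le_trans (by simp)
    (Finset.single_le_sum (f := fun T : Finset Ω => t ^ T.card) (fun T _ => by positivity)
      (show (∅ : Finset Ω) ∈ _ by simp))

/-- Sequential composition of two families of fingerprints. -/
noncomputable def bindFamily {Ω β δ : Type*} (𝒜 : Finset (Finset Ω × β))
    (ℬ : Finset Ω × β → Finset (Finset Ω × δ)) : Finset (Finset Ω × δ) :=
  (𝒜.sigma fun z => (ℬ z).filter fun u => Disjoint z.1 u.1).image fun s =>
    (s.1.1 ∪ s.2.1, s.2.2)

theorem mem_bindFamily {Ω β δ : Type*} {𝒜 : Finset (Finset Ω × β)}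
    {ℬ : Finset Ω × β → Finset (Finset Ω × δ)} {v : Finset Ω × δ} :
    v ∈ bindFamily 𝒜 ℬ ↔ ∃ z ∈ 𝒜, ∃ u ∈ ℬ z, Disjoint z.1 u.1 ∧ (z.1 ∪ u.1, u.2) = v := by
  simp only [bindFamily, Finset.mem_image, Finset.mem_sigma, Finset.mem_filter, Sigma.exists]
  aesop

theorem sum_image_le_sum {α β : Type*} (s : Finset α) (φ : α → β) {f : β → ℝ}
    (hf : ∀ y, 0 ≤ f y) : ∑ y ∈ s.image φ, f y ≤ ∑ a ∈ s, f (φ a) := by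
  rw [Finset.sum_comp f φ]
  refine Finset.sum_le_sum fun y hy => ?_
  obtain ⟨a, ha, rfl⟩ := Finset.mem_image.1 hy
  have : 1 ≤ (s.filter fun a' => φ a' = φ a).card :=
    Finset.card_pos.2 ⟨a, Finset.mem_filter.2 ⟨ha, rfl⟩⟩
  rw [nsmul_eq_mul]
  exact le_mul_of_one_le_left (hf _) (by exact_mod_cast this)

theorem sum_bindFamily_le {Ω β δ : Type*} {𝒜 : Finset (Finset Ω × β)}
    {ℬ : Finset Ω × β → Finset (Finset Ω × δ)} {t A B : ℝ} (ht : 0 ≤ t) (hB : 0 ≤ B)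
    (hA : ∑ z ∈ 𝒜, t ^ z.1.card ≤ A) (hℬ : ∀ z ∈ 𝒜, ∑ u ∈ ℬ z, t ^ u.1.card ≤ B) :
    ∑ v ∈ bindFamily 𝒜 ℬ, t ^ v.1.card ≤ A * B := by
  calc ∑ v ∈ bindFamily 𝒜 ℬ, t ^ v.1.card
      ≤ ∑ z ∈ 𝒜, ∑ u ∈ (ℬ z).filter fun u => Disjoint z.1 u.1, t ^ (z.1 ∪ u.1).card := by
        rw [Finset.sum_sigma']
        unfold bindFamily
        convert sum_image_le_sum (𝒜.sigma fun z => (ℬ z).filter fun u => Disjoint z.1 u.1)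
          (fun s : (_ : Finset Ω × β) × (Finset Ω × δ) => (s.1.1 ∪ s.2.1, s.2.2))
          (f := fun v : Finset Ω × δ => t ^ v.1.card)
          fun v => by positivity
    _ ≤ ∑ z ∈ 𝒜, t ^ z.1.card * B := by
        refine Finset.sum_le_sum fun z hz => ?_
        calc ∑ u ∈ (ℬ z).filter fun u => Disjoint z.1 u.1, t ^ (z.1 ∪ u.1).card
            = ∑ u ∈ (ℬ z).filter fun u => Disjoint z.1 u.1, t ^ z.1.card * t ^ u.1.card := by
              refine Finset.sum_congr rfl fun u hu => ?_
              rw [Finset.card_union_of_disjoint (Finset.mem_filter.1 hu).2, pow_add]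
          _ ≤ ∑ u ∈ ℬ z, t ^ z.1.card * t ^ u.1.card :=
              Finset.sum_le_sum_of_subset_of_nonneg (Finset.filter_subset _ _)
                fun _ _ _ => by positivity
          _ ≤ _ := by
              rw [← Finset.mul_sum]
              exact mul_le_mul_of_nonneg_left (hℬ z hz) (by positivity)
    _ ≤ A * B := by
        rw [← Finset.sum_mul]
        exact mul_le_mul_of_nonneg_right hA hB

/-- A maximal feasible fingerprint `T` of size at most `b`: either it has full size or all members
of `I` rooted at heavy values conflict with the chosen ones. -/
theorem exists_feasible_fingerprint {ι X Ω γ : Type*} [Fintype X] {x : γ → ι → X} {root : Ω → X}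
    {conf : Ω → Ω → Prop} (hsymm : ∀ ω ω', conf ω ω' → conf ω' ω)
    (hroot : ∀ ω ω', root ω = root ω' → conf ω ω') {𝓦 : Finset γ} {Q : Finset ι} {i : ι}
    {θ D D' β : ℝ} (hi : i ∈ Q) (hθ : 0 < θ) (hD : CodegLE x 𝓦 Q θ D) (hDD' : D * θ ≤ D' / 2)
    (hD' : 0 ≤ D') (b : ℕ) (V : Finset X → Finset γ)
    (hV : ∀ Y, (∃ 𝓥, Feasible x 𝓦 Q i θ D' β Y 𝓥) → Feasible x 𝓦 Q i θ D' β Y (V Y))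
    (I P : Finset Ω) (hP : (P : Set Ω).Pairwise fun ω ω' => ¬ conf ω ω') :
    ∃ T ⊆ I, Disjoint P T ∧ ((P ∪ T : Finset Ω) : Set Ω).Pairwise (fun ω ω' => ¬ conf ω ω') ∧
      T.card ≤ b ∧ Feasible x 𝓦 Q i θ D' β (T.image root) (V (T.image root)) ∧
      (T.card < b → ∀ ω ∈ I, root ω ∈ heavy x 𝓦 (V (T.image root)) Q i θ D' β →
        ∃ ω' ∈ P ∪ T, conf ω ω') := by
  set 𝒞 := I.powerset.filter fun T => Disjoint P T ∧
    ((P ∪ T : Finset Ω) : Set Ω).Pairwise (fun ω ω' => ¬ conf ω ω') ∧ T.card ≤ b ∧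
    Feasible x 𝓦 Q i θ D' β (T.image root) (V (T.image root)) with h𝒞
  have hne : 𝒞.Nonempty := by
    refine ⟨∅, ?_⟩
    simp only [h𝒞, Finset.mem_filter, Finset.mem_powerset, Finset.empty_subset, true_and,
      Finset.disjoint_empty_right, Finset.union_empty, Finset.card_empty, zero_le,
      Finset.image_empty]
    refine ⟨hP, hV _ ⟨∅, by simp, by simp, ?_, by simp⟩⟩
    intro S _ _ ψ
    have hp : 0 ≤ θ ^ (S.card - 1) := by positivity
    simpa [codeg] using mul_nonneg hD' hp
  obtain ⟨T, hT, hmax⟩ := Finset.exists_max_image 𝒞 Finset.card hne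
  simp only [h𝒞, Finset.mem_filter, Finset.mem_powerset] at hT
  obtain ⟨hTI, hPT, hpair, hTb, hfeas⟩ := hT
  refine ⟨T, hTI, hPT, hpair, hTb, hfeas, fun hlt ω hω hheavy => ?_⟩
  by_contra hcon
  push Not at hcon
  have hωnot : ω ∉ P ∪ T := fun h => hcon ω h (hroot ω ω rfl)
  have hωP : ω ∉ P := fun h => hωnot (Finset.mem_union_left _ h)
  have hωT : ω ∉ T := fun h => hωnot (Finset.mem_union_right _ h)
  have hmem : insert ω T ∈ 𝒞 := by
    simp only [h𝒞, Finset.mem_filter, Finset.mem_powerset]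
    refine ⟨Finset.insert_subset hω hTI, ?_, ?_, ?_, ?_⟩
    · rw [Finset.disjoint_insert_right]
      exact ⟨hωP, hPT⟩
    · rw [Finset.union_insert, Finset.coe_insert]
      refine hpair.insert fun ω' hω' _ => ⟨hcon ω' hω', fun h => hcon ω' hω' (hsymm _ _ h)⟩
    · rw [Finset.card_insert_of_notMem hωT]
      exact hlt
    · rw [Finset.image_insert]
      exact hV _ ⟨_, feasible_insert hfeas hi hθ hD hDD' (Finset.mem_filter.1 hheavy).2⟩
  have := hmax _ hmem
  rw [Finset.card_insert_of_notMem hωT] at this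
  omega

theorem Feasible.card_le {ι X γ : Type*} {x : γ → ι → X} {𝓦 : Finset γ} {Q : Finset ι}
    {i : ι} {θ D D' β : ℝ} {Y : Finset X} {𝓥 : Finset γ} (hF : Feasible x 𝓦 Q i θ D' β Y 𝓥)
    (hi : i ∈ Q) (hD : CodegLE x 𝓦 Q θ D) : (𝓥.card : ℝ) ≤ Y.card * D := by
  rw [Finset.card_eq_sum_card_fiberwise (f := fun g => x g i) (t := Y)
    (fun g hg => hF.mem g hg)]
  push_cast
  rw [← nsmul_eq_mul, ← Finset.sum_const]
  refine Finset.sum_le_sum fun y _ => le_trans ?_ (hD.card_fiber_le hi y)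
  exact_mod_cast Finset.card_le_card (Finset.filter_subset_filter _ hF.subset)

theorem Feasible.mul_le_card {ι X γ : Type*} {x : γ → ι → X} {𝓦 : Finset γ} {Q : Finset ι}
    {i : ι} {θ D' β : ℝ} {Y : Finset X} {𝓥 : Finset γ} (hF : Feasible x 𝓦 Q i θ D' β Y 𝓥) :
    Y.card * β ≤ (𝓥.card : ℝ) := by
  rw [Finset.card_eq_sum_card_fiberwise (f := fun g => x g i) (t := Y)
    (fun g hg => hF.mem g hg)]
  push_cast
  rw [← nsmul_eq_mul, ← Finset.sum_const]
  exact Finset.sum_le_sum fun y hy => hF.le_card y hy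

/-- One round of the container argument: a small family of pairs of a fingerprint and a large
set of values avoided by it which captures every conflict-free configuration spanning few members
of `𝓦`. -/
theorem exists_capturing_family (k : ℕ) : ∀ ε κ : ℝ, 0 < ε → 0 < κ → ∃ c a : ℝ, 0 < c ∧ 0 < a ∧
    ∀ {ι : Type u₁} {X : Type u₂} {Ω : Type u₃} {γ : Type u₄} [Fintype X] [Fintype Ω]
      (x : γ → ι → X) (root : Ω → X) (conf : Ω → Ω → Prop),
      (∀ ω ω', conf ω ω' → conf ω' ω) → (∀ ω ω', root ω = root ω' → conf ω ω') →
      ∀ (Q : Finset ι) (𝓦 : Finset γ) (θ N w t : ℝ) (b : ℕ), Q.card = k → 0 < θ → 0 < N →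
        0 < w → 0 ≤ t → (b : ℝ) = θ * N → (Fintype.card X : ℝ) ≤ N → ε * w ≤ 𝓦.card →
        CodegLE x 𝓦 Q θ (κ * w / N) →
        ∃ 𝒵 : Finset (Finset Ω × Finset X), ∑ z ∈ 𝒵, t ^ z.1.card ≤ smallSetSum Ω t b ^ k ∧
          (∀ z ∈ 𝒵, z.1.card ≤ k * b ∧ c * N ≤ z.2.card ∧ ∀ y ∈ z.2, ∃ g ∈ 𝓦, ∃ i, x g i = y) ∧
          ∀ I P : Finset Ω, P ⊆ I → (P : Set Ω).Pairwise (fun ω ω' => ¬ conf ω ω') →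
            (∀ g ∈ 𝓦, ∀ i ∉ Q, x g i ∈ P.image root) →
            SpansFew x root conf 𝓦 I (a * θ ^ k * w) →
            ∃ z ∈ 𝒵, Captures root conf I P z := by
  induction k with
  | zero =>
    intro ε κ hε hκ
    refine ⟨1, ε, one_pos, hε, ?_⟩
    intro ι X Ω γ _ _ x root conf hsymm hroot Q 𝓦 θ N w t b hQ hθ hN hw ht hb hX h𝓦 hD
    refine ⟨∅, by simp, by simp, fun I P hPI hP hPQ hfew => ?_⟩
    exfalso
    have h := hfew P hPI hP
    rw [Finset.card_eq_zero] at hQ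
    rw [Finset.filter_true_of_mem fun g hg i => hPQ g hg i (by simp [hQ])] at h
    simp only [pow_zero, mul_one] at h
    linarith
  | succ k ih =>
    intro ε κ hε hκ
    set κ' : ℝ := 2 * κ + 2 ^ k * 8 * κ ^ 2 / ε with hκ'
    have hκ'0 : 0 < κ' := by positivity
    have hκ'1 : 2 ^ k * 8 * κ ^ 2 / ε ≤ κ' := by rw [hκ']; linarith
    have hκ'2 : 2 * κ ≤ κ' := by
      have : 0 ≤ 2 ^ k * 8 * κ ^ 2 / ε := by positivity
      rw [hκ']; linarith
    obtain ⟨c₁, a, hc₁, ha, ih⟩ := ih (ε / 4) κ' (by positivity) hκ'0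
    refine ⟨min c₁ (ε / (2 * κ)), a, by positivity, ha, ?_⟩
    intro ι X Ω γ _ _ x root conf hsymm hroot Q 𝓦 θ N w t b hQ hθ hN hw ht hb hX h𝓦 hD
    obtain ⟨i, hi⟩ : Q.Nonempty := by
      rw [← Finset.card_pos]; omega
    have hQi : (Q.erase i).card = k := by rw [Finset.card_erase_of_mem hi]; omega
    set D' : ℝ := κ' * (θ * w) / N with hD'
    set β : ℝ := ε * w / (4 * N) with hβ
    have hD'0 : 0 ≤ D' := by positivity
    have hDD' : κ * w / N * θ ≤ D' / 2 := by
      have h0 : 0 ≤ θ * w / N := by positivity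
      have := mul_le_mul_of_nonneg_right hκ'2 h0
      calc κ * w / N * θ = 2 * κ * (θ * w / N) / 2 := by ring
        _ ≤ κ' * (θ * w / N) / 2 := by linarith
        _ = D' / 2 := by rw [hD']; ring
    have hB1 := one_le_smallSetSum Ω ht b
    have hexV : ∀ Y : Finset X, ∃ 𝓥 : Finset γ, (∃ 𝓥, Feasible x 𝓦 Q i θ D' β Y 𝓥) →
        Feasible x 𝓦 Q i θ D' β Y 𝓥 := by
      intro Y
      by_cases h : ∃ 𝓥, Feasible x 𝓦 Q i θ D' β Y 𝓥
      · exact ⟨h.choose, fun _ => h.choose_spec⟩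
      · exact ⟨∅, fun h' => absurd h' h⟩
    choose V hV using hexV
    -- the continuation after the fingerprint `T` in coordinate `i`
    have hnext : ∀ T : Finset Ω, ∃ 𝒵 : Finset (Finset Ω × Finset X),
        ∑ z ∈ 𝒵, t ^ z.1.card ≤ smallSetSum Ω t b ^ k ∧
        (∀ z ∈ 𝒵, z.1.card ≤ k * b ∧ min c₁ (ε / (2 * κ)) * N ≤ z.2.card ∧
          ∀ y ∈ z.2, ∃ g ∈ 𝓦, ∃ i, x g i = y) ∧
        ∀ I P : Finset Ω, P ⊆ I → (P : Set Ω).Pairwise (fun ω ω' => ¬ conf ω ω') →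
          (∀ g ∈ 𝓦, ∀ i ∉ Q, x g i ∈ P.image root) →
          SpansFew x root conf 𝓦 I (a * θ ^ (k + 1) * w) → T ⊆ P → T.card ≤ b →
          Feasible x 𝓦 Q i θ D' β (T.image root) (V (T.image root)) →
          (T.card < b → ∀ ω ∈ I, root ω ∈ heavy x 𝓦 (V (T.image root)) Q i θ D' β →
            ∃ ω' ∈ P, conf ω ω') →
          ∃ z ∈ 𝒵, Captures root conf I P z := by
      intro T
      by_cases hfeas : T.card ≤ b ∧ Feasible x 𝓦 Q i θ D' β (T.image root) (V (T.image root))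
      swap
      · refine ⟨∅, by simp; positivity, by simp, ?_⟩
        intro I P _ _ _ _ _ h1 h2
        exact absurd ⟨h1, h2⟩ hfeas
      obtain ⟨hTb, hfeas⟩ := hfeas
      have hVcard : ((V (T.image root)).card : ℝ) ≤ κ * θ * w := by
        refine (hfeas.card_le hi hD).trans ?_
        have h1 : ((T.image root).card : ℝ) ≤ θ * N := by
          rw [← hb]
          exact_mod_cast Finset.card_image_le.trans hTb
        calc _ ≤ θ * N * (κ * w / N) := mul_le_mul_of_nonneg_right h1 (by positivity)
          _ = κ * θ * w := by field_simp
      rcases hTb.lt_or_eq with hlt | heq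
      · refine ⟨{(∅, heavy x 𝓦 (V (T.image root)) Q i θ D' β)}, ?_, ?_, ?_⟩
        · simpa using one_le_pow₀ hB1
        · intro z hz
          rw [Finset.mem_singleton] at hz
          subst hz
          refine ⟨by simp, ?_, ?_⟩
          · refine le_trans (mul_le_mul_of_nonneg_right (min_le_right _ _) hN.le) ?_
            exact le_card_heavy hi hθ hN hw hε hκ (by rwa [hQ, Nat.add_sub_cancel]) hX h𝓦 hD hVcard
          · intro y hy
            have h := (Finset.mem_filter.1 hy).2
            have hpos : 0 < ((unsaturated x 𝓦 (V (T.image root)) Q i θ D').filter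
                fun g => x g i = y).card := by
              have : (0 : ℝ) < β := by positivity
              exact_mod_cast this.trans_le h
            obtain ⟨g, hg⟩ := Finset.card_pos.1 hpos
            rw [Finset.mem_filter] at hg
            exact ⟨g, Finset.filter_subset _ _ hg.1, i, hg.2⟩
        · intro I P hPI hP _ _ _ _ _ hcov
          refine ⟨_, Finset.mem_singleton_self _, by simp, by simp, by simpa using hP, ?_⟩
          simpa using hcov hlt
      · by_cases hinj : Set.InjOn root (T : Set Ω)
        · have hcardY : ((T.image root).card : ℝ) = θ * N := by
            rw [Finset.card_image_of_injOn hinj, heq, hb]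
          have hVge : ε / 4 * (θ * w) ≤ (V (T.image root)).card := by
            refine le_trans (le_of_eq ?_) hfeas.mul_le_card
            rw [hcardY, hβ]
            field_simp
          obtain ⟨𝒵, hsum, hmem, hcap⟩ := ih x root conf hsymm hroot (Q.erase i)
            (V (T.image root)) θ N (θ * w) t b hQi hθ hN (by positivity) ht hb hX hVge
            hfeas.codegLE
          refine ⟨𝒵, hsum, ?_, ?_⟩
          · intro z hz
            obtain ⟨h1, h2, h3⟩ := hmem z hz
            refine ⟨h1, le_trans (mul_le_mul_of_nonneg_right (min_le_left _ _) hN.le) h2, ?_⟩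
            intro y hy
            obtain ⟨g, hg, hgy⟩ := h3 y hy
            exact ⟨g, hfeas.subset hg, hgy⟩
          · intro I P hPI hP hPQ hfew hTP _ _ _
            refine hcap I P hPI hP ?_ ?_
            · intro g hg j hj
              by_cases hji : j = i
              · subst hji
                exact Finset.image_subset_image hTP (hfeas.mem g hg)
              · exact hPQ g (hfeas.subset hg) j fun h => hj (Finset.mem_erase.2 ⟨hji, h⟩)
            · convert hfew.mono hfeas.subset using 1
              ring
        · refine ⟨∅, by simp; positivity, by simp, ?_⟩
          intro I P _ hP _ _ hTP _ _ _
          refine absurd (fun ω hω ω' hω' h => ?_) hinj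
          by_contra hne
          exact hP (hTP hω) (hTP hω') hne (hroot _ _ h)
    choose 𝒵 hsum hmem hcap using hnext
    refine ⟨bindFamily (((Finset.univ : Finset (Finset Ω)).filter fun T => T.card ≤ b).image
      fun T => (T, ())) fun z => 𝒵 z.1, ?_, ?_, ?_⟩
    · rw [pow_succ']
      refine sum_bindFamily_le ht (by positivity) (le_of_eq ?_) fun z _ => hsum z.1
      rw [Finset.sum_image fun _ _ _ _ h => (Prod.ext_iff.1 h).1]
      rfl
    · intro v hv
      obtain ⟨z, hz, u, hu, _, rfl⟩ := mem_bindFamily.1 hv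
      simp only [Finset.mem_image, Finset.mem_filter, Finset.mem_univ, true_and] at hz
      obtain ⟨T, hT, rfl⟩ := hz
      obtain ⟨h1, h2, h3⟩ := hmem _ u hu
      refine ⟨(Finset.card_union_le _ _).trans ?_, h2, h3⟩
      simp only
      linarith
    · intro I P hPI hP hPQ hfew
      obtain ⟨T, hTI, hPT, hpair, hTb, hfeas, hcov⟩ := exists_feasible_fingerprint hsymm hroot
        hi hθ hD hDD' hD'0 b V hV I P hP
      obtain ⟨u, hu, hcapt⟩ := hcap T I (P ∪ T) (Finset.union_subset hPI hTI) hpair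
        (fun g hg j hj => Finset.image_subset_image Finset.subset_union_left (hPQ g hg j hj))
        hfew Finset.subset_union_right hTb hfeas hcov
      have hd := Finset.disjoint_union_left.1 hcapt.disjoint
      refine ⟨(T ∪ u.1, u.2), mem_bindFamily.2 ⟨(T, ()), by simpa using hTb, u, hu, hd.2, rfl⟩,
        ?_⟩
      refine ⟨Finset.union_subset hTI hcapt.subset, ?_, ?_, ?_⟩
      · exact Finset.disjoint_union_right.2 ⟨hPT, hd.1⟩
      · simpa only [Finset.union_assoc] using hcapt.pairwise
      · simpa only [Finset.union_assoc] using hcapt.conflict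

/-- Iterated rounds: the avoided set of values grows until few members of `γ` avoid it. -/
theorem exists_container_family (r : ℕ) (ε κ : ℝ) (hε : 0 < ε) (hκ : 0 < κ) :
    ∃ (L : ℕ) (a : ℝ), 0 < L ∧ 0 < a ∧
    ∀ {ι : Type u₁} {X : Type u₂} {Ω : Type u₃} {γ : Type u₄} [Fintype ι] [Fintype X]
      [Fintype Ω] [Fintype γ]
      (x : γ → ι → X) (root : Ω → X) (conf : Ω → Ω → Prop),
      (∀ ω ω', conf ω ω' → conf ω' ω) → (∀ ω ω', root ω = root ω' → conf ω ω') →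
      ∀ (θ N w t : ℝ) (b : ℕ), Fintype.card ι = r → 0 < θ → 0 < N →
        0 < w → 0 ≤ t → (b : ℝ) = θ * N → (Fintype.card X : ℝ) ≤ N →
        CodegLE x Finset.univ Finset.univ θ (κ * w / N) →
        ∃ 𝒵 : Finset (Finset Ω × Finset X),
          ∑ z ∈ 𝒵, t ^ z.1.card ≤ smallSetSum Ω t b ^ (L * r) ∧
          (∀ z ∈ 𝒵, z.1.card ≤ L * r * b ∧
            ((Finset.univ.filter fun g => ∀ i, x g i ∉ z.2).card : ℝ) < ε * w) ∧
          ∀ I : Finset Ω, SpansFew x root conf Finset.univ I (a * θ ^ r * w) →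
            ∃ z ∈ 𝒵, Captures root conf I ∅ z := by
  obtain ⟨c, a, hc, ha, hround⟩ := exists_capturing_family.{u₁, u₂, u₃, u₄} r ε κ hε hκ
  obtain ⟨L, hL⟩ := exists_nat_gt (1 / c)
  have hL0 : 0 < L := by
    have : (0 : ℝ) < L := lt_trans (by positivity) hL
    exact_mod_cast this
  refine ⟨L, a, hL0, ha, ?_⟩
  intro ι X Ω γ _ _ _ _ x root conf hsymm hroot θ N w t b hr hθ hN hw ht hb hX hD
  have hB1 := one_le_smallSetSum Ω ht b
  have main : ∀ ℓ : ℕ, ∀ R : Finset X, ((L : ℝ) - ℓ) * (c * N) ≤ R.card →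
      ∃ 𝒵 : Finset (Finset Ω × Finset X),
        ∑ z ∈ 𝒵, t ^ z.1.card ≤ smallSetSum Ω t b ^ (ℓ * r) ∧
        (∀ z ∈ 𝒵, z.1.card ≤ ℓ * r * b ∧
          ((Finset.univ.filter fun g => ∀ i, x g i ∉ z.2).card : ℝ) < ε * w) ∧
        ∀ I P : Finset Ω, P ⊆ I → (P : Set Ω).Pairwise (fun ω ω' => ¬ conf ω ω') →
          (∀ ω ∈ I, root ω ∈ R → ∃ ω' ∈ P, conf ω ω') →
          SpansFew x root conf Finset.univ I (a * θ ^ r * w) →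
          ∃ z ∈ 𝒵, Captures root conf I P z := by
    intro ℓ
    induction ℓ with
    | zero =>
      intro R hR
      exfalso
      have h1 : (R.card : ℝ) ≤ N := le_trans (by exact_mod_cast R.card_le_univ) hX
      rw [div_lt_iff₀ hc] at hL
      simp only [Nat.cast_zero, sub_zero] at hR
      nlinarith
    | succ ℓ ih =>
      intro R hR
      set 𝓦 : Finset γ := Finset.univ.filter fun g => ∀ i, x g i ∉ R with h𝓦
      by_cases hsmall : (𝓦.card : ℝ) < ε * w
      · refine ⟨{(∅, R)}, by simpa using one_le_pow₀ hB1, by simpa using hsmall, ?_⟩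
        intro I P hPI hP hcov _
        exact ⟨_, Finset.mem_singleton_self _, by simp, by simp, by simpa using hP,
          by simpa using hcov⟩
      push Not at hsmall
      have hD𝓦 : CodegLE x 𝓦 Finset.univ θ (κ * w / N) := hD.mono (Finset.subset_univ _)
      obtain ⟨𝒜, hAsum, hAmem, hAcap⟩ := hround x root conf hsymm hroot Finset.univ 𝓦 θ N w t b
        (by simpa using hr) hθ hN hw ht hb hX hsmall hD𝓦
      have hnext : ∀ z : Finset Ω × Finset X, ∃ ℬ : Finset (Finset Ω × Finset X), z ∈ 𝒜 →
          ∑ z ∈ ℬ, t ^ z.1.card ≤ smallSetSum Ω t b ^ (ℓ * r) ∧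
          (∀ z ∈ ℬ, z.1.card ≤ ℓ * r * b ∧
            ((Finset.univ.filter fun g => ∀ i, x g i ∉ z.2).card : ℝ) < ε * w) ∧
          ∀ I P : Finset Ω, P ⊆ I → (P : Set Ω).Pairwise (fun ω ω' => ¬ conf ω ω') →
            (∀ ω ∈ I, root ω ∈ R ∪ z.2 → ∃ ω' ∈ P, conf ω ω') →
            SpansFew x root conf Finset.univ I (a * θ ^ r * w) →
            ∃ z ∈ ℬ, Captures root conf I P z := by
        intro z
        by_cases hz : z ∈ 𝒜
        · obtain ⟨_, h2, h3⟩ := hAmem z hz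
          have hdisj : Disjoint R z.2 := by
            rw [Finset.disjoint_right]
            intro y hy hyR
            obtain ⟨g, hg, i, hgi⟩ := h3 y hy
            exact (Finset.mem_filter.1 hg).2 i (hgi ▸ hyR)
          obtain ⟨ℬ, hℬ⟩ := ih (R ∪ z.2) (by
            rw [Finset.card_union_of_disjoint hdisj]
            push_cast at hR ⊢
            linarith)
          exact ⟨ℬ, fun _ => hℬ⟩
        · exact ⟨∅, fun h => absurd h hz⟩
      choose ℬ hℬ using hnext
      refine ⟨bindFamily 𝒜 ℬ, ?_, ?_, ?_⟩
      · rw [Nat.succ_mul, add_comm, pow_add]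
        exact sum_bindFamily_le ht (by positivity) hAsum fun z hz => (hℬ z hz).1
      · intro v hv
        obtain ⟨z, hz, u, hu, _, rfl⟩ := mem_bindFamily.1 hv
        obtain ⟨h1, h2⟩ := (hℬ z hz).2.1 u hu
        refine ⟨(Finset.card_union_le _ _).trans ?_, h2⟩
        have := (hAmem z hz).1
        rw [Nat.succ_mul, Nat.add_mul]
        omega
      · intro I P hPI hP hcov hfew
        obtain ⟨z, hz, hzc⟩ := hAcap I P hPI hP (fun _ _ i hi => absurd (Finset.mem_univ i) hi)
          (hfew.mono (Finset.subset_univ _))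
        obtain ⟨u, hu, huc⟩ := (hℬ z hz).2.2 I (P ∪ z.1) (Finset.union_subset hPI hzc.subset)
          hzc.pairwise (by
            intro ω hω hroot
            rcases Finset.mem_union.1 hroot with h | h
            · obtain ⟨ω', hω', hc⟩ := hcov ω hω h
              exact ⟨ω', Finset.mem_union_left _ hω', hc⟩
            · exact hzc.conflict ω hω h) hfew
        have hd := Finset.disjoint_union_left.1 huc.disjoint
        refine ⟨(z.1 ∪ u.1, u.2), mem_bindFamily.2 ⟨z, hz, u, hu, hd.2, rfl⟩, ?_⟩
        refine ⟨Finset.union_subset hzc.subset huc.subset,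
          Finset.disjoint_union_right.2 ⟨hzc.disjoint, hd.1⟩, ?_, ?_⟩
        · simpa only [Finset.union_assoc] using huc.pairwise
        · simpa only [Finset.union_assoc] using huc.conflict
  obtain ⟨𝒵, h1, h2, h3⟩ := main L ∅ (by simp)
  exact ⟨𝒵, h1, h2, fun I hI => h3 I ∅ (by simp) (by simp) (by simp) hI⟩

end Containers

section RandomSubset

/-- Expectation of `φ` of a binomial random subset of `U`. -/
noncomputable def expect {α : Type*} (U : Finset α) (p : ℝ) (φ : Finset α → ℝ) : ℝ :=
  ∑ S ∈ U.powerset, p ^ S.card * (1 - p) ^ (U.card - S.card) * φ S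

variable {α : Type*} {U : Finset α} {p : ℝ}

theorem expect_mono (hp₀ : 0 ≤ p) (hp₁ : p ≤ 1) {φ ψ : Finset α → ℝ}
    (h : ∀ S ⊆ U, φ S ≤ ψ S) : expect U p φ ≤ expect U p ψ := by
  have hp₂ : 0 ≤ 1 - p := by linarith
  exact Finset.sum_le_sum fun S hS =>
    mul_le_mul_of_nonneg_left (h S (Finset.mem_powerset.1 hS)) (by positivity)

theorem expect_sub (φ ψ : Finset α → ℝ) :
    expect U p (fun S => φ S - ψ S) = expect U p φ - expect U p ψ := by
  simp only [expect, mul_sub, Finset.sum_sub_distrib]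

theorem expect_const_mul (c : ℝ) (φ : Finset α → ℝ) :
    expect U p (fun S => c * φ S) = c * expect U p φ := by
  simp only [expect, Finset.mul_sum]
  exact Finset.sum_congr rfl fun S _ => by ring

theorem expect_sum {τ : Type*} (s : Finset τ) (φ : τ → Finset α → ℝ) :
    expect U p (fun S => ∑ j ∈ s, φ j S) = ∑ j ∈ s, expect U p (φ j) := by
  simp only [expect, Finset.mul_sum]
  exact Finset.sum_comm

theorem expect_one : expect U p (fun _ => 1) = 1 := by
  simp [expect, Finset.sum_pow_mul_eq_add_pow]

theorem expect_indicator_mem {e : α} (he : e ∈ U) (φ : Finset α → ℝ) :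
    expect U p (fun S => (if e ∈ S then 1 else 0) * φ S) =
      p * expect U p (fun S => φ (insert e S)) := by
  obtain ⟨U', he', rfl⟩ : ∃ U', e ∉ U' ∧ insert e U' = U :=
    ⟨U.erase e, by simp, Finset.insert_erase he⟩
  simp only [expect]
  rw [Finset.sum_powerset_insert he', Finset.sum_powerset_insert he', ← Finset.sum_add_distrib,
    ← Finset.sum_add_distrib, Finset.mul_sum]
  refine Finset.sum_congr rfl fun S hS => ?_
  rw [Finset.mem_powerset] at hS
  have heS : e ∉ S := fun h => he' (hS h)
  have hcard := Finset.card_le_card hS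
  rw [Finset.card_insert_of_notMem heS, Finset.card_insert_of_notMem he',
    Nat.add_sub_add_right, Nat.sub_add_comm hcard]
  simp only [heS, if_false, Finset.mem_insert_self, if_true, Finset.insert_idem]
  ring

theorem expect_indicator_subset {D : Finset α} (hD : D ⊆ U) (φ : Finset α → ℝ) :
    expect U p (fun S => (if D ⊆ S then 1 else 0) * φ S) =
      p ^ D.card * expect U p (fun S => φ (S ∪ D)) := by
  induction D using Finset.induction_on generalizing φ with
  | empty => simp
  | insert e D he ih =>
    rw [Finset.insert_subset_iff] at hD
    have h1 : (fun S : Finset α => (if insert e D ⊆ S then (1 : ℝ) else 0) * φ S) =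
        fun S => (if D ⊆ S then 1 else 0) * ((if e ∈ S then 1 else 0) * φ S) := by
      funext S
      by_cases h1 : e ∈ S <;> by_cases h2 : D ⊆ S <;> simp [Finset.insert_subset_iff, h1, h2]
    have h2 : (fun S : Finset α => (if e ∈ S ∪ D then (1 : ℝ) else 0) * φ (S ∪ D)) =
        fun S => (if e ∈ S then 1 else 0) * φ (S ∪ D) := by
      funext S
      simp [he]
    rw [h1, ih hD.2, h2, expect_indicator_mem hD.1, Finset.card_insert_of_notMem he, pow_succ,
      mul_assoc]
    congr 3
    funext S
    rw [Finset.insert_union, Finset.union_insert]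

theorem expect_indicator_subset_le (hp₀ : 0 ≤ p) (hp₁ : p ≤ 1) {D : Finset α} (hD : D ⊆ U)
    {φ : Finset α → ℝ} (hφ : Antitone φ) :
    expect U p (fun S => (if D ⊆ S then 1 else 0) * φ S) ≤ p ^ D.card * expect U p φ := by
  rw [expect_indicator_subset hD]
  exact mul_le_mul_of_nonneg_left
    (expect_mono hp₀ hp₁ fun S _ => hφ Finset.subset_union_left) (by positivity)

theorem one_sub_sum_le_prod {τ : Type*} (s : Finset τ) (f : τ → ℝ) (h₀ : ∀ j, 0 ≤ f j)
    (h₁ : ∀ j, f j ≤ 1) : 1 - ∑ j ∈ s, f j ≤ ∏ j ∈ s, (1 - f j) := by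
  induction s using Finset.induction_on with
  | empty => simp
  | insert a s ha ih =>
    rw [Finset.sum_insert ha, Finset.prod_insert ha]
    have h2 : ∏ j ∈ s, (1 - f j) ≤ 1 :=
      Finset.prod_le_one (fun j _ => by linarith [h₁ j]) fun j _ => by linarith [h₀ j]
    nlinarith [h₀ a, h₁ a]

/-- The weight `∏ (1 - s)` over the sets of the family that are contained in `S`. -/
noncomputable def dampedWeight {τ : Type*} (D : τ → Finset α) (s : ℝ) (𝓗 : Finset τ)
    (S : Finset α) : ℝ :=
  ∏ h ∈ 𝓗, (1 - s * if D h ⊆ S then 1 else 0)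

section Damped

variable {τ : Type*} {D : τ → Finset α} {s : ℝ}

theorem damped_factor_mem (hs₀ : 0 ≤ s) (hs₁ : s ≤ 1) (h : τ) (S : Finset α) :
    0 ≤ s * (if D h ⊆ S then (1 : ℝ) else 0) ∧ s * (if D h ⊆ S then (1 : ℝ) else 0) ≤ 1 := by
  split_ifs <;> simp [hs₀, hs₁]

theorem dampedWeight_nonneg (hs₀ : 0 ≤ s) (hs₁ : s ≤ 1) (𝓗 : Finset τ) (S : Finset α) :
    0 ≤ dampedWeight D s 𝓗 S :=
  Finset.prod_nonneg fun h _ => by linarith [(damped_factor_mem (D := D) hs₀ hs₁ h S).2]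

theorem dampedWeight_antitone (hs₀ : 0 ≤ s) (hs₁ : s ≤ 1) (𝓗 : Finset τ) :
    Antitone (dampedWeight D s 𝓗) := by
  intro S S' hSS'
  refine Finset.prod_le_prod
    (fun h _ => by linarith [(damped_factor_mem (D := D) hs₀ hs₁ h S').2]) fun h _ => ?_
  by_cases h1 : D h ⊆ S
  · simp [h1, h1.trans hSS']
  · simp only [h1, if_false, mul_zero, sub_zero]
    linarith [(damped_factor_mem (D := D) hs₀ hs₁ h S').1]

theorem half_mul_expect_dampedWeight_le (hp₀ : 0 ≤ p) (hp₁ : p ≤ 1) (hs₀ : 0 ≤ s) (hs₁ : s ≤ 1)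
    (𝓗 : Finset τ) (hDU : ∀ h, D h ⊆ U) (h₀ : τ)
    (hK : s * ∑ h ∈ 𝓗.filter (fun h => ¬ Disjoint (D h₀) (D h)), p ^ (D h \ D h₀).card ≤ 1 / 2) :
    p ^ (D h₀).card / 2 * expect U p (dampedWeight D s 𝓗) ≤
      expect U p (fun S => (if D h₀ ⊆ S then 1 else 0) * dampedWeight D s 𝓗 S) := by
  set 𝓐 := 𝓗.filter (fun h => ¬ Disjoint (D h₀) (D h)) with h𝓐
  set ℬ := 𝓗.filter (fun h => Disjoint (D h₀) (D h)) with hℬ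
  have hsplit : ∀ S, dampedWeight D s 𝓗 S = dampedWeight D s ℬ S * dampedWeight D s 𝓐 S :=
    fun S => (Finset.prod_filter_mul_prod_filter_not 𝓗 _ _).symm
  have hℬ0 := fun S => dampedWeight_nonneg (D := D) hs₀ hs₁ ℬ S
  have hle : expect U p (dampedWeight D s 𝓗) ≤ expect U p (dampedWeight D s ℬ) := by
    refine expect_mono hp₀ hp₁ fun S _ => ?_
    rw [hsplit]
    refine mul_le_of_le_one_right (hℬ0 S) ?_
    exact Finset.prod_le_one
      (fun h _ => by linarith [(damped_factor_mem (D := D) hs₀ hs₁ h S).2])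
      fun h _ => by linarith [(damped_factor_mem (D := D) hs₀ hs₁ h S).1]
  have hindep : expect U p (fun S => (if D h₀ ⊆ S then 1 else 0) * dampedWeight D s ℬ S) =
      p ^ (D h₀).card * expect U p (dampedWeight D s ℬ) := by
    rw [expect_indicator_subset (hDU h₀)]
    congr 2
    funext S
    refine Finset.prod_congr rfl fun h hh => ?_
    have hdis := (Finset.mem_filter.1 hh).2
    have : D h ⊆ S ∪ D h₀ ↔ D h ⊆ S :=
      ⟨fun hsub a ha =>
          (Finset.mem_union.1 (hsub ha)).resolve_right (Finset.disjoint_right.1 hdis ha),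
        fun hsub => hsub.trans Finset.subset_union_left⟩
    simp only [this]
  have hpair : ∀ h, expect U p (fun S => (if D h₀ ∪ D h ⊆ S then 1 else 0) *
      dampedWeight D s ℬ S) ≤
      p ^ (D h₀).card * p ^ (D h \ D h₀).card * expect U p (dampedWeight D s ℬ) := by
    intro h
    refine (expect_indicator_subset_le hp₀ hp₁ (Finset.union_subset (hDU h₀) (hDU h))
      (dampedWeight_antitone hs₀ hs₁ ℬ)).trans (le_of_eq ?_)
    rw [← pow_add, ← Finset.union_sdiff_self_eq_union,
      Finset.card_union_of_disjoint Finset.disjoint_sdiff]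
  have hlow : expect U p (fun S => (if D h₀ ⊆ S then 1 else 0) * dampedWeight D s ℬ S) -
      s * ∑ h ∈ 𝓐, expect U p (fun S => (if D h₀ ∪ D h ⊆ S then 1 else 0) *
        dampedWeight D s ℬ S) ≤
      expect U p (fun S => (if D h₀ ⊆ S then 1 else 0) * dampedWeight D s 𝓗 S) := by
    rw [← expect_sum, ← expect_const_mul, ← expect_sub]
    refine expect_mono hp₀ hp₁ fun S _ => ?_
    rw [hsplit]
    by_cases h0 : D h₀ ⊆ S
    · have h1 := one_sub_sum_le_prod 𝓐 (fun h => s * if D h ⊆ S then (1 : ℝ) else 0)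
        (fun h => (damped_factor_mem hs₀ hs₁ h S).1) fun h => (damped_factor_mem hs₀ hs₁ h S).2
      have h2 := mul_le_mul_of_nonneg_left h1 (hℬ0 S)
      simp only [h0, if_true, one_mul, Finset.union_subset_iff, true_and]
      refine le_trans (le_of_eq ?_) h2
      rw [← Finset.mul_sum, ← Finset.sum_mul]
      ring
    · simp [h0, Finset.union_subset_iff]
  have hE0 : 0 ≤ expect U p (dampedWeight D s ℬ) := by
    have := expect_mono (U := U) hp₀ hp₁ (φ := fun _ => 0) fun S _ => hℬ0 S
    simpa [expect] using this
  have hP0 : 0 ≤ p ^ (D h₀).card := by positivity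
  have hsum := mul_le_mul_of_nonneg_left (Finset.sum_le_sum fun h (_ : h ∈ 𝓐) => hpair h) hs₀
  rw [← Finset.sum_mul, ← Finset.mul_sum] at hsum
  have hPE : 0 ≤ p ^ (D h₀).card * expect U p (dampedWeight D s ℬ) := mul_nonneg hP0 hE0
  have hK' := mul_le_mul_of_nonneg_left hK hPE
  have hle' := mul_le_mul_of_nonneg_left hle hP0
  rw [hindep] at hlow
  linarith

/-- Janson-type inequality for families in which every set has bounded conditional expected
number of intersecting partners. -/
theorem expect_no_subset_le_exp (hp₀ : 0 ≤ p) (hp₁ : p ≤ 1) (𝓗 : Finset τ) (m : ℕ)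
    (hDU : ∀ h, D h ⊆ U) (hDm : ∀ h, (D h).card = m) {K : ℝ} (hK1 : 1 ≤ K)
    (hK : ∀ h₀, ∑ h ∈ 𝓗.filter (fun h => ¬ Disjoint (D h₀) (D h)), p ^ (D h \ D h₀).card ≤ K) :
    expect U p (fun S => if ∃ h ∈ 𝓗, D h ⊆ S then 0 else 1) ≤
      Real.exp (-(𝓗.card * p ^ m / (4 * K))) := by
  set s : ℝ := 1 / (2 * K) with hs
  have hK0 : 0 < K := by linarith
  have hs₀ : 0 ≤ s := by positivity
  have hs₁ : s ≤ 1 := by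
    rw [hs, div_le_one (by positivity)]; linarith
  have hpm : p ^ m ≤ 1 := pow_le_one₀ hp₀ hp₁
  have hpm0 : 0 ≤ p ^ m := by positivity
  have hstep : ∀ ℋ ⊆ 𝓗, expect U p (dampedWeight D s ℋ) ≤ (1 - s * p ^ m / 2) ^ ℋ.card := by
    intro ℋ
    induction ℋ using Finset.induction_on with
    | empty =>
      intro _
      have hone : dampedWeight D s ∅ = fun _ => 1 := by
        funext S
        simp [dampedWeight]
      rw [hone, expect_one]
      simp
    | insert h₀ ℋ hh ih =>
      intro hsub
      have hsub' := (Finset.subset_insert h₀ ℋ).trans hsub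
      have hexp : expect U p (dampedWeight D s (insert h₀ ℋ)) =
          expect U p (dampedWeight D s ℋ) -
            s * expect U p (fun S => (if D h₀ ⊆ S then 1 else 0) * dampedWeight D s ℋ S) := by
        rw [← expect_const_mul, ← expect_sub]
        congr 1
        funext S
        simp only [dampedWeight, Finset.prod_insert hh]
        ring
      have hle : s * ∑ h ∈ ℋ.filter (fun h => ¬ Disjoint (D h₀) (D h)),
          p ^ (D h \ D h₀).card ≤ 1 / 2 := by
        calc _ ≤ s * K := by
              refine mul_le_mul_of_nonneg_left (le_trans ?_ (hK h₀)) hs₀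
              exact Finset.sum_le_sum_of_subset_of_nonneg (Finset.filter_subset_filter _ hsub')
                fun _ _ _ => by positivity
          _ = 1 / 2 := by rw [hs]; field_simp
      have hhalf := half_mul_expect_dampedWeight_le (U := U) hp₀ hp₁ hs₀ hs₁ ℋ hDU h₀ hle
      rw [hDm] at hhalf
      have hfac : 0 ≤ 1 - s * p ^ m / 2 := by nlinarith
      rw [Finset.card_insert_of_notMem hh, pow_succ', hexp]
      have := mul_le_mul_of_nonneg_left (ih hsub') hfac
      have := mul_le_mul_of_nonneg_left hhalf hs₀
      linarith
  calc expect U p (fun S => if ∃ h ∈ 𝓗, D h ⊆ S then 0 else 1)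
      ≤ expect U p (dampedWeight D s 𝓗) := by
        refine expect_mono hp₀ hp₁ fun S _ => ?_
        split_ifs with hex
        · exact dampedWeight_nonneg hs₀ hs₁ 𝓗 S
        · push Not at hex
          unfold dampedWeight
          rw [Finset.prod_eq_one]
          intro h hh
          simp [hex h hh]
    _ ≤ (1 - s * p ^ m / 2) ^ 𝓗.card := hstep 𝓗 subset_rfl
    _ ≤ Real.exp (-(s * p ^ m / 2)) ^ 𝓗.card := by
        refine pow_le_pow_left₀ (by nlinarith) ?_ _
        linarith [Real.add_one_le_exp (-(s * p ^ m / 2))]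
    _ = Real.exp (-(𝓗.card * p ^ m / (4 * K))) := by
        rw [← Real.exp_nat_mul, hs]
        congr 1
        field_simp
        ring

end Damped

end RandomSubset

theorem smallSetSum_le (Ω : Type*) [Fintype Ω] {t lam : ℝ} (ht : 0 ≤ t) (hl₀ : 0 < lam)
    (hl₁ : lam ≤ 1) (b : ℕ) :
    smallSetSum Ω t b ≤ Real.exp (b * Real.log (1 / lam) + lam * (Fintype.card Ω * t)) := by
  have hpos : 0 < lam ^ b := by positivity
  have h1 : smallSetSum Ω t b * lam ^ b ≤ (1 + lam * t) ^ Fintype.card Ω := by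
    have hbin : (1 + lam * t) ^ Fintype.card Ω = ∑ T : Finset Ω, (lam * t) ^ T.card := by
      have := Finset.sum_pow_mul_eq_add_pow (lam * t) 1 (Finset.univ : Finset Ω)
      simp only [one_pow, mul_one, Finset.powerset_univ, Finset.card_univ] at this
      rw [this, add_comm]
    rw [hbin, smallSetSum, Finset.sum_mul]
    refine le_trans (Finset.sum_le_sum fun T hT => ?_)
      (Finset.sum_le_sum_of_subset_of_nonneg (Finset.filter_subset _ _)
        fun T _ _ => by positivity)
    rw [mul_pow, mul_comm]
    refine mul_le_mul_of_nonneg_right ?_ (by positivity)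
    exact pow_le_pow_of_le_one hl₀.le hl₁ (Finset.mem_filter.1 hT).2
  have h2 : (1 + lam * t) ^ Fintype.card Ω ≤ Real.exp (lam * (Fintype.card Ω * t)) := by
    calc _ ≤ Real.exp (lam * t) ^ Fintype.card Ω := by
          refine pow_le_pow_left₀ (by positivity) ?_ _
          linarith [Real.add_one_le_exp (lam * t)]
      _ = _ := by
          rw [← Real.exp_nat_mul]
          congr 1
          ring
  have h3 : Real.exp (b * Real.log (1 / lam)) * lam ^ b = 1 := by
    rw [Real.exp_nat_mul, Real.exp_log (by positivity), ← mul_pow]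
    field_simp
    simp
  rw [Real.exp_add]
  refine le_of_mul_le_mul_right ?_ hpos
  calc _ ≤ _ := h1.trans h2
    _ = Real.exp (b * Real.log (1 / lam)) * lam ^ b * Real.exp (lam * (Fintype.card Ω * t)) := by
        rw [h3, one_mul]
    _ = _ := by ring

section Supersaturation

/-- Ramsey's theorem for two colours, with the colour classes given by `R` and its complement. -/
theorem exists_ramsey_number (k l : ℕ) : ∃ M : ℕ, k ≤ M ∧ l ≤ M ∧
    ∀ {α : Type u₁} (A : Finset α) (R : Set (Sym2 α)), M ≤ A.card →
      (∃ B ⊆ A, B.card = k ∧ ∀ x ∈ B, ∀ y ∈ B, x ≠ y → s(x, y) ∉ R) ∨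
        ∃ B ⊆ A, B.card = l ∧ ∀ x ∈ B, ∀ y ∈ B, x ≠ y → s(x, y) ∈ R := by
  induction k generalizing l with
  | zero => exact ⟨l, by omega, le_rfl, fun A R _ => Or.inl ⟨∅, by simp⟩⟩
  | succ k ihk =>
    induction l with
    | zero => exact ⟨k + 1, le_rfl, by omega, fun A R _ => Or.inr ⟨∅, by simp⟩⟩
    | succ l ihl =>
      obtain ⟨M₁, hk₁, hl₁, h₁⟩ := ihk (l + 1)
      obtain ⟨M₂, hk₂, hl₂, h₂⟩ := ihl
      refine ⟨M₁ + M₂ + 1, by omega, by omega, fun {α} A R hA => ?_⟩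
      obtain ⟨a, ha⟩ : A.Nonempty := Finset.card_pos.1 (by omega)
      have hsplit := Finset.card_filter_add_card_filter_not (s := A.erase a) (fun y => s(a, y) ∈ R)
      rw [Finset.card_erase_of_mem ha] at hsplit
      have hextend : ∀ B ⊆ A.erase a, insert a B ⊆ A ∧ (insert a B).card = B.card + 1 :=
        fun B hB => ⟨Finset.insert_subset ha (hB.trans (Finset.erase_subset _ _)),
          Finset.card_insert_of_notMem fun h => by simpa using hB h⟩
      have hpair : ∀ (Q : Sym2 α → Prop) (B : Finset α), (∀ y ∈ B, Q s(a, y)) →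
          (∀ x ∈ B, ∀ y ∈ B, x ≠ y → Q s(x, y)) →
          ∀ x ∈ insert a B, ∀ y ∈ insert a B, x ≠ y → Q s(x, y) := by
        intro Q B ha' hB x hx y hy hxy
        rw [Finset.mem_insert] at hx hy
        rcases hx with rfl | hx <;> rcases hy with rfl | hy
        · exact absurd rfl hxy
        · exact ha' y hy
        · rw [Sym2.eq_swap]
          exact ha' x hx
        · exact hB x hx y hy hxy
      by_cases hM : M₁ ≤ ((A.erase a).filter fun y => ¬ s(a, y) ∈ R).card
      · rcases h₁ _ R hM with ⟨B, hBA, hBk, hB⟩ | ⟨B, hBA, hBl, hB⟩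
        · obtain ⟨h3, h4⟩ := hextend B (hBA.trans (Finset.filter_subset _ _))
          exact Or.inl ⟨insert a B, h3, by rw [h4, hBk],
            hpair (· ∉ R) B (fun y hy => (Finset.mem_filter.1 (hBA hy)).2) hB⟩
        · exact Or.inr ⟨B, hBA.trans ((Finset.filter_subset _ _).trans (Finset.erase_subset _ _)),
            hBl, hB⟩
      · have hM₂ : M₂ ≤ ((A.erase a).filter fun y => s(a, y) ∈ R).card := by omega
        rcases h₂ _ R hM₂ with ⟨B, hBA, hBk, hB⟩ | ⟨B, hBA, hBl, hB⟩
        · exact Or.inl ⟨B, hBA.trans ((Finset.filter_subset _ _).trans (Finset.erase_subset _ _)),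
            hBk, hB⟩
        · obtain ⟨h3, h4⟩ := hextend B (hBA.trans (Finset.filter_subset _ _))
          exact Or.inr ⟨insert a B, h3, by rw [h4, hBl],
            hpair (· ∈ R) B (fun y hy => (Finset.mem_filter.1 (hBA hy)).2) hB⟩

/-- A family of embeddings whose values on `T` are restricted to sets of size at most `s`. -/
theorem card_embeddings_le {V : Type*} [Fintype V] {n s : ℕ} (T : Finset V)
    (C : V → Finset (Fin n)) (hC : ∀ v ∈ T, (C v).card ≤ s) (𝓕 : Finset (V ↪ Fin n))
    (h𝓕 : ∀ f ∈ 𝓕, ∀ v ∈ T, f v ∈ C v) :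
    𝓕.card ≤ s ^ T.card * n ^ (Fintype.card V - T.card) := by
  have hmaps : 𝓕.card ≤ (Fintype.piFinset fun v => if v ∈ T then C v else Finset.univ).card := by
    refine Finset.card_le_card_of_injOn (fun f => (f : V → Fin n)) (fun f hf => ?_)
      fun f _ f' _ hff' => DFunLike.coe_injective hff'
    simp only [Finset.mem_coe, Fintype.mem_piFinset]
    intro v
    split_ifs with hv
    · exact h𝓕 f hf v hv
    · exact Finset.mem_univ _
  refine hmaps.trans ?_
  rw [Fintype.card_piFinset, ← Finset.prod_mul_prod_compl T]
  refine Nat.mul_le_mul ?_ ?_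
  · refine (Finset.prod_le_pow_card T _ s fun v hv => ?_)
    simpa [hv] using hC v hv
  · rw [Finset.prod_congr rfl (g := fun _ => n) fun v hv => by
      simp [Finset.mem_compl.1 hv]]
    rw [Finset.prod_const, Finset.card_compl]

theorem card_le_of_forall_exists_trans {V : Type*} [Fintype V] {M n : ℕ} (P : (V ↪ Fin n) → Prop)
    [DecidablePred P] (Φ : Finset (Fin M ↪ Fin n))
    (hΦ : ∀ φ ∈ Φ, ∃ g₀ : V ↪ Fin M, P (g₀.trans φ)) :
    Φ.card ≤ M ^ Fintype.card V * (Finset.univ.filter P).card * n ^ (M - Fintype.card V) := by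
  have hsub : Φ ⊆ ((Finset.univ : Finset (V ↪ Fin M)) ×ˢ Finset.univ.filter P).biUnion
      fun z => Finset.univ.filter fun φ : Fin M ↪ Fin n => z.1.trans φ = z.2 := by
    intro φ hφ
    obtain ⟨g₀, hg₀⟩ := hΦ φ hφ
    exact Finset.mem_biUnion.2 ⟨(g₀, g₀.trans φ), by simp [hg₀], by simp⟩
  have hfib : ∀ z ∈ (Finset.univ : Finset (V ↪ Fin M)) ×ˢ Finset.univ.filter P,
      (Finset.univ.filter fun φ : Fin M ↪ Fin n => z.1.trans φ = z.2).card ≤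
        n ^ (M - Fintype.card V) := by
    rintro ⟨g₀, g⟩ -
    have := card_embeddings_le (n := n) (s := 1) (Finset.univ.map g₀)
      (fun u => Finset.univ.filter fun y => ∃ v, g₀ v = u ∧ g v = y) (fun u _ => by
        refine Finset.card_le_one.2 fun y hy y' hy' => ?_
        simp only [Finset.mem_filter, Finset.mem_univ, true_and] at hy hy'
        obtain ⟨v, hv, rfl⟩ := hy
        obtain ⟨v', hv', rfl⟩ := hy'
        rw [g₀.injective (hv.trans hv'.symm)])
      (Finset.univ.filter fun φ : Fin M ↪ Fin n => g₀.trans φ = g) (fun φ hφ u hu => by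
        obtain ⟨v, -, rfl⟩ := Finset.mem_map.1 hu
        simp only [Finset.mem_filter, Finset.mem_univ, true_and] at hφ ⊢
        exact ⟨v, rfl, by rw [← hφ]; rfl⟩)
    simpa using this
  refine (Finset.card_le_card hsub).trans ((Finset.card_biUnion_le_card_mul _ _ _ hfib).trans ?_)
  rw [Finset.card_product, Finset.card_univ, Fintype.card_embedding_eq, Fintype.card_fin]
  gcongr
  exact Nat.descFactorial_le_pow _ _

theorem exists_embedding_of_card_eq {V α : Type*} [Fintype V] (G : SimpleGraph V) {B : Finset α}
    (hB : B.card = Fintype.card V) {Q : Sym2 α → Prop}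
    (hQ : ∀ x ∈ B, ∀ y ∈ B, x ≠ y → Q s(x, y)) :
    ∃ g : V ↪ α, ∀ e ∈ G.edgeSet, Q (Sym2.map g e) := by
  obtain ⟨f⟩ : Nonempty (V ≃ B) := ⟨Fintype.equivOfCardEq (by simp [hB])⟩
  refine ⟨f.toEmbedding.trans (Function.Embedding.subtype _), fun e => ?_⟩
  induction e with
  | _ x y =>
    intro hxy
    refine hQ _ (f x).2 _ (f y).2 fun h => ?_
    exact (SimpleGraph.ne_of_adj G hxy) (f.injective (Subtype.ext h))

/-- Supersaturated form of Ramsey's theorem. -/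
theorem exists_many_copies {V W : Type*} [Fintype V] [Fintype W] (G : SimpleGraph V)
    (H : SimpleGraph W) : ∃ ε : ℝ, 0 < ε ∧ ∃ n₀ : ℕ, ∀ n ≥ n₀, ∀ R : Finset (Sym2 (Fin n)),
      ε * (n : ℝ) ^ Fintype.card V ≤
          ((Finset.univ.filter fun g : V ↪ Fin n =>
            ∀ e ∈ G.edgeSet, Sym2.map g e ∉ R).card : ℝ) ∨
        ε * (n : ℝ) ^ Fintype.card W ≤
          ((Finset.univ.filter fun h : W ↪ Fin n =>
            ∀ e ∈ H.edgeSet, Sym2.map h e ∈ R).card : ℝ) := by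
  obtain ⟨M, hVM, hWM, hM⟩ := exists_ramsey_number.{0} (Fintype.card V) (Fintype.card W)
  have hden : (0 : ℝ) < 2 ^ (M + 1) * (M + 1) ^ M := by positivity
  refine ⟨1 / (2 ^ (M + 1) * (M + 1) ^ M), by positivity, 2 * M + 1, fun n hn R => ?_⟩
  set Φ₁ := Finset.univ.filter fun φ : Fin M ↪ Fin n =>
    ∃ g₀ : V ↪ Fin M, ∀ e ∈ G.edgeSet, Sym2.map (g₀.trans φ) e ∉ R with hΦ₁
  set Φ₂ := Finset.univ.filter fun φ : Fin M ↪ Fin n =>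
    ∃ h₀ : W ↪ Fin M, ∀ e ∈ H.edgeSet, Sym2.map (h₀.trans φ) e ∈ R with hΦ₂
  have hcover : (Finset.univ : Finset (Fin M ↪ Fin n)) ⊆ Φ₁ ∪ Φ₂ := by
    intro φ _
    rcases hM (Finset.univ : Finset (Fin M)) {e | Sym2.map φ e ∈ R} (by simp) with
      ⟨B, -, hBc, hB⟩ | ⟨B, -, hBc, hB⟩
    · obtain ⟨g₀, hg₀⟩ := exists_embedding_of_card_eq G hBc (Q := fun e => Sym2.map φ e ∉ R) hB
      refine Finset.mem_union_left _ (Finset.mem_filter.2 ⟨Finset.mem_univ _, g₀, fun e he => ?_⟩)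
      have := hg₀ e he
      rw [Sym2.map_map] at this
      exact this
    · obtain ⟨g₀, hg₀⟩ := exists_embedding_of_card_eq H hBc (Q := fun e => Sym2.map φ e ∈ R) hB
      refine Finset.mem_union_right _ (Finset.mem_filter.2 ⟨Finset.mem_univ _, g₀, fun e he => ?_⟩)
      have := hg₀ e he
      rw [Sym2.map_map] at this
      exact this
  have hcard := (Finset.card_le_card hcover).trans (Finset.card_union_le _ _)
  rw [Finset.card_univ, Fintype.card_embedding_eq, Fintype.card_fin, Fintype.card_fin] at hcard
  have hpow : n ^ M ≤ 2 ^ M * n.descFactorial M := by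
    calc n ^ M ≤ (2 * (n + 1 - M)) ^ M := Nat.pow_le_pow_left (by omega) _
      _ = 2 ^ M * (n + 1 - M) ^ M := mul_pow _ _ _
      _ ≤ _ := Nat.mul_le_mul_left _ (Nat.pow_sub_le_descFactorial n M)
  have hfinish : ∀ (v K Φ : ℕ), v ≤ M → Φ ≤ M ^ v * K * n ^ (M - v) →
      n ^ M ≤ 2 ^ (M + 1) * Φ →
      1 / (2 ^ (M + 1) * (M + 1) ^ M) * (n : ℝ) ^ v ≤ (K : ℝ) := by
    intro v K Φ hv h1 h2
    have h3 : n ^ v * n ^ (M - v) ≤ 2 ^ (M + 1) * (M + 1) ^ M * K * n ^ (M - v) := by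
      rw [← pow_add, Nat.add_sub_cancel' hv]
      calc n ^ M ≤ 2 ^ (M + 1) * (M ^ v * K * n ^ (M - v)) := h2.trans (Nat.mul_le_mul_left _ h1)
        _ ≤ 2 ^ (M + 1) * ((M + 1) ^ M * K * n ^ (M - v)) := by
            refine Nat.mul_le_mul_left _ (Nat.mul_le_mul_right _ (Nat.mul_le_mul_right _ ?_))
            exact (Nat.pow_le_pow_left (Nat.le_succ M) v).trans
              (Nat.pow_le_pow_right (Nat.succ_pos M) hv)
        _ = _ := by ring
    have h4 := Nat.le_of_mul_le_mul_right h3 (Nat.pow_pos (by omega))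
    rw [one_div, inv_mul_le_iff₀ hden]
    exact_mod_cast h4
  have hor : n ^ M ≤ 2 ^ (M + 1) * Φ₁.card ∨ n ^ M ≤ 2 ^ (M + 1) * Φ₂.card := by
    by_contra! hcon
    have := hpow.trans (Nat.mul_le_mul_left _ hcard)
    rw [pow_succ, mul_assoc, mul_assoc] at hcon
    nlinarith
  rcases hor with h | h
  · exact Or.inl (hfinish _ _ _ hVM
      (card_le_of_forall_exists_trans (fun g : V ↪ Fin n => ∀ e ∈ G.edgeSet, Sym2.map g e ∉ R) Φ₁
        fun φ hφ => (Finset.mem_filter.1 hφ).2) h)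
  · exact Or.inr (hfinish _ _ _ hWM
      (card_le_of_forall_exists_trans (fun g : W ↪ Fin n => ∀ e ∈ H.edgeSet, Sym2.map g e ∈ R) Φ₂
        fun φ hφ => (Finset.mem_filter.1 hφ).2) h)

end Supersaturation

section Densities

variable {V : Type*}

/-- The vertices covered by a set of pairs. -/
noncomputable def spanVerts (S : Finset (Sym2 V)) : Finset V :=
  S.biUnion fun e => e.toFinset

theorem mem_spanVerts {S : Finset (Sym2 V)} {v : V} : v ∈ spanVerts S ↔ ∃ e ∈ S, v ∈ e := by
  simp [spanVerts]

/-- The subgraph formed by a set of edges and the vertices they cover. -/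
noncomputable def spanSubgraph (G : SimpleGraph V) (S : Finset (Sym2 V)) (hS : ↑S ⊆ G.edgeSet) :
    G.Subgraph where
  verts := spanVerts S
  Adj u v := s(u, v) ∈ S
  adj_sub h := hS h
  edge_vert h := mem_spanVerts.2 ⟨_, h, Sym2.mem_mk_left _ _⟩
  symm := ⟨fun u v h => by rwa [Sym2.eq_swap]⟩

theorem spanSubgraph_edgeSet (G : SimpleGraph V) (S : Finset (Sym2 V)) (hS : ↑S ⊆ G.edgeSet) :
    (spanSubgraph G S hS).edgeSet = ↑S := by
  ext e
  induction e with
  | _ u v => rfl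

theorem two_le_card_spanVerts {G : SimpleGraph V} {S : Finset (Sym2 V)} (hS : ↑S ⊆ G.edgeSet)
    (hne : S.Nonempty) : 2 ≤ (spanVerts S).card := by
  obtain ⟨e, he⟩ := hne
  rw [← Sym2.card_toFinset_of_not_isDiag e (G.not_isDiag_of_mem_edgeSet (hS he))]
  exact Finset.card_le_card (Finset.subset_biUnion_of_mem (fun e : Sym2 V => e.toFinset) he)

theorem three_le_card_spanVerts {G : SimpleGraph V} {S : Finset (Sym2 V)} (hS : ↑S ⊆ G.edgeSet)
    (h2 : 2 ≤ S.card) : 3 ≤ (spanVerts S).card := by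
  by_contra! hlt
  obtain ⟨e, he, e', he', hne⟩ := Finset.one_lt_card.1 h2
  have key : ∀ f ∈ S, f.toFinset = spanVerts S := fun f hf =>
    Finset.eq_of_subset_of_card_le
      (Finset.subset_biUnion_of_mem (fun e : Sym2 V => e.toFinset) hf) (by
        rw [Sym2.card_toFinset_of_not_isDiag f (G.not_isDiag_of_mem_edgeSet (hS hf))]
        omega)
  refine hne (Sym2.ext fun v => ?_)
  rw [← Sym2.mem_toFinset, ← Sym2.mem_toFinset, key e he, key e' he']

variable [Fintype V]

theorem d2_le_m2 (G : SimpleGraph V) (J : G.Subgraph) :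
    d2 J.verts.ncard J.edgeSet.ncard ≤ m2 G := by
  refine le_csSup ?_ ⟨J, rfl⟩
  have hset : {x : ℝ | ∃ J : G.Subgraph, x = d2 J.verts.ncard J.edgeSet.ncard} =
      Set.range fun J : G.Subgraph => d2 J.verts.ncard J.edgeSet.ncard := by
    ext x
    simp [eq_comm]
  rw [hset]
  exact (Set.finite_range _).bddAbove

theorem half_le_m2 {G : SimpleGraph V} (hG : G.edgeSet.Nonempty) : 1 / 2 ≤ m2 G := by
  obtain ⟨e, he⟩ := hG
  have hS : ↑({e} : Finset (Sym2 V)) ⊆ G.edgeSet := by simpa using he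
  have h := d2_le_m2 G (spanSubgraph G {e} hS)
  rw [spanSubgraph_edgeSet] at h
  have hv : (spanSubgraph G {e} hS).verts.ncard = 2 := by
    change (↑(spanVerts {e}) : Set V).ncard = 2
    rw [Set.ncard_coe_finset, spanVerts, Finset.singleton_biUnion,
      Sym2.card_toFinset_of_not_isDiag e (G.not_isDiag_of_mem_edgeSet he)]
  rw [hv, Set.ncard_coe_finset, Finset.card_singleton, d2] at h
  norm_num at h
  linarith

theorem m2_pos {G : SimpleGraph V} (hG : G.edgeSet.Nonempty) : 0 < m2 G := by
  linarith [half_le_m2 hG]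

theorem card_sub_one_le_m2_mul (G : SimpleGraph V) {S : Finset (Sym2 V)} (hS : ↑S ⊆ G.edgeSet)
    (hne : S.Nonempty) (hm : 0 < m2 G) :
    (S.card : ℝ) - 1 ≤ m2 G * ((spanVerts S).card - 2) := by
  have h2 : (2 : ℝ) ≤ (spanVerts S).card := by exact_mod_cast two_le_card_spanVerts hS hne
  rcases Nat.lt_or_ge 1 S.card with hc | hc
  · have h3 := three_le_card_spanVerts hS hc
    have h := d2_le_m2 G (spanSubgraph G S hS)
    have hv : (spanSubgraph G S hS).verts.ncard = (spanVerts S).card := Set.ncard_coe_finset _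
    rw [spanSubgraph_edgeSet, hv, Set.ncard_coe_finset, d2, if_neg (by omega), if_pos h3] at h
    have h3' : (3 : ℝ) ≤ (spanVerts S).card := by exact_mod_cast h3
    rwa [div_le_iff₀ (by linarith)] at h
  · have : (S.card : ℝ) ≤ 1 := by exact_mod_cast hc
    nlinarith

theorem mStar_mem_nonneg (H : SimpleGraph V) {x : ℝ} (hx : ∃ J : H.Subgraph,
    2 ≤ J.verts.ncard ∧ J.verts.ncard < Fintype.card V ∧
      x = ((H.edgeSet.ncard : ℝ) - (J.edgeSet.ncard : ℝ)) /
        ((Fintype.card V : ℝ) - (J.verts.ncard : ℝ))) : 0 ≤ x := by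
  obtain ⟨J, -, h, rfl⟩ := hx
  have h1 : (J.edgeSet.ncard : ℝ) ≤ H.edgeSet.ncard := by
    exact_mod_cast Set.ncard_le_ncard J.edgeSet_subset (Set.toFinite _)
  have h2 : (J.verts.ncard : ℝ) ≤ Fintype.card V := by exact_mod_cast h.le
  exact div_nonneg (by linarith) (by linarith)

theorem mStar_nonneg (H : SimpleGraph V) : 0 ≤ mStar H :=
  Real.sInf_nonneg fun _ hx => mStar_mem_nonneg H hx

theorem mStar_mul_le (H : SimpleGraph V) {S : Finset (Sym2 V)} (hS : ↑S ⊆ H.edgeSet)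
    (hne : S.Nonempty) (hlt : (spanVerts S).card < Fintype.card V) :
    mStar H * ((Fintype.card V : ℝ) - (spanVerts S).card) ≤ H.edgeSet.ncard - S.card := by
  have hv : (spanSubgraph H S hS).verts.ncard = (spanVerts S).card := Set.ncard_coe_finset _
  have h : mStar H ≤ ((H.edgeSet.ncard : ℝ) - S.card) /
      ((Fintype.card V : ℝ) - (spanVerts S).card) := by
    refine csInf_le ⟨0, fun x hx => mStar_mem_nonneg H hx⟩ ⟨spanSubgraph H S hS, ?_, ?_, ?_⟩
    · rw [hv]
      exact two_le_card_spanVerts hS hne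
    · rwa [hv]
    · rw [hv, spanSubgraph_edgeSet, Set.ncard_coe_finset]
  have : ((spanVerts S).card : ℝ) < Fintype.card V := by exact_mod_cast hlt
  rwa [le_div_iff₀ (by linarith)] at h

theorem mStar_pos_of_lt_xStar (H : SimpleGraph V) {x : ℝ} (hx₀ : 0 < x) (hx : x < xStar H) :
    0 < mStar H := by
  refine lt_of_le_of_ne (mStar_nonneg H) fun h => ?_
  rw [xStar, ← h, zero_div] at hx
  linarith

theorem d2a_le_m2a {W : Type*} [Fintype W] (G : SimpleGraph V) (H : SimpleGraph W)
    (hG : G.edgeSet.Nonempty) (hH : H.edgeSet.Nonempty) :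
    (H.edgeSet.ncard : ℝ) / ((Fintype.card W : ℝ) - 2 + 1 / m2 G) ≤ m2a G H := by
  have hmem : d2a G (⊤ : H.Subgraph).verts.ncard (⊤ : H.Subgraph).edgeSet.ncard ≤ m2a G H := by
    refine le_csSup ?_ ⟨⊤, rfl⟩
    have hset : {x : ℝ | ∃ J : H.Subgraph, x = d2a G J.verts.ncard J.edgeSet.ncard} =
        Set.range fun J : H.Subgraph => d2a G J.verts.ncard J.edgeSet.ncard := by
      ext x
      simp [eq_comm]
    rw [hset]
    exact (Set.finite_range _).bddAbove
  have h1 : G.edgeSet.ncard ≠ 0 := (Set.ncard_pos (Set.toFinite _)).2 hG |>.ne'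
  have h2 : H.edgeSet.ncard ≠ 0 := (Set.ncard_pos (Set.toFinite _)).2 hH |>.ne'
  rw [SimpleGraph.Subgraph.edgeSet_top, SimpleGraph.Subgraph.verts_top, Set.ncard_univ,
    Nat.card_eq_fintype_card, d2a, if_neg (by tauto)] at hmem
  exact hmem

theorem mul_pow_le_one_of_le_rpow {n p m : ℝ} {d k : ℕ} (hn : 1 ≤ n) (hp : 0 ≤ p) (hm : 0 < m)
    (hpn : p ≤ n ^ (-(1 / m))) (hk : m * d ≤ k) : n ^ d * p ^ k ≤ 1 := by
  have hn0 : 0 < n := by linarith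
  calc n ^ d * p ^ k ≤ n ^ d * (n ^ (-(1 / m))) ^ k := by gcongr
    _ = n ^ ((d : ℝ) + -(1 / m) * k) := by
        rw [← Real.rpow_natCast, ← Real.rpow_natCast, ← Real.rpow_mul hn0.le, Real.rpow_add hn0]
    _ ≤ 1 := by
        refine Real.rpow_le_one_of_one_le_of_nonpos hn ?_
        have : (d : ℝ) ≤ 1 / m * k := by
          rw [one_div, inv_mul_eq_div, le_div_iff₀ hm]
          linarith
        linarith

theorem one_le_mul_pow_of_rpow_le {n t m : ℝ} {d k : ℕ} (hn : 1 ≤ n) (hm : 0 < m)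
    (htn : n ^ (-(1 / m)) ≤ t) (hk : (k : ℝ) ≤ m * d) : 1 ≤ n ^ d * t ^ k := by
  have hn0 : 0 < n := by linarith
  calc 1 ≤ n ^ ((d : ℝ) + -(1 / m) * k) := by
        refine Real.one_le_rpow hn ?_
        have : 1 / m * k ≤ d := by
          rw [one_div, inv_mul_eq_div, div_le_iff₀ hm]
          linarith
        linarith
    _ = n ^ d * (n ^ (-(1 / m))) ^ k := by
        rw [← Real.rpow_natCast, ← Real.rpow_natCast, ← Real.rpow_mul hn0.le, Real.rpow_add hn0]
    _ ≤ n ^ d * t ^ k := by gcongr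

/-- Any edge set `S` of `H` extends to few expected copies of `H`. -/
theorem pow_card_sub_mul_pow_le_one (H : SimpleGraph V) (hm : 0 < mStar H) {n p : ℝ}
    (hn : 1 ≤ n) (hp : 0 ≤ p) (hpn : p ≤ n ^ (-(1 / mStar H))) {S : Finset (Sym2 V)}
    (hS : ↑S ⊆ H.edgeSet) (hne : S.Nonempty) :
    n ^ (Fintype.card V - (spanVerts S).card) * p ^ (H.edgeSet.ncard - S.card) ≤ 1 := by
  refine mul_pow_le_one_of_le_rpow hn hp hm hpn ?_
  have hcS : S.card ≤ H.edgeSet.ncard := by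
    rw [← Set.ncard_coe_finset]
    exact Set.ncard_le_ncard hS (Set.toFinite _)
  rcases (Finset.card_le_univ (spanVerts S)).lt_or_eq with h | h
  · rw [Nat.cast_sub h.le, Nat.cast_sub hcS]
    exact mStar_mul_le H hS hne h
  · rw [h, Nat.sub_self, Nat.cast_zero, mul_zero]
    positivity

/-- The lower bound on `p` in terms of the expected number of copies of `H` at an edge. -/
theorem mul_rpow_le_pow_mul_pow {W : Type*} [Fintype W] (G : SimpleGraph V) (H : SimpleGraph W)
    (hG : G.edgeSet.Nonempty) (hH : H.edgeSet.Nonempty) (hW : 2 ≤ Fintype.card W) {n p C : ℝ}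
    (hn : 1 ≤ n) (hC : 1 ≤ C) (hp : C * n ^ (-(1 / m2a G H)) ≤ p) :
    C * n ^ (-(1 / m2 G)) ≤ n ^ (Fintype.card W - 2) * p ^ H.edgeSet.ncard := by
  have hn0 : 0 < n := by linarith
  have hm := m2_pos hG
  have hW' : (2 : ℝ) ≤ Fintype.card W := by exact_mod_cast hW
  have he : 0 < H.edgeSet.ncard := (Set.ncard_pos (Set.toFinite _)).2 hH
  have he' : (0 : ℝ) < H.edgeSet.ncard := by exact_mod_cast he
  have hden : 0 < (Fintype.card W : ℝ) - 2 + 1 / m2 G := by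
    have : 0 < 1 / m2 G := by positivity
    linarith
  have hle := d2a_le_m2a G H hG hH
  have hma : 0 < m2a G H := lt_of_lt_of_le (by positivity) hle
  have hexp : -(1 / m2 G) ≤ ((Fintype.card W - 2 : ℕ) : ℝ) + -(1 / m2a G H) * H.edgeSet.ncard := by
    rw [div_le_iff₀ hden] at hle
    have : 1 / m2a G H * H.edgeSet.ncard ≤ (Fintype.card W : ℝ) - 2 + 1 / m2 G := by
      rw [one_div, inv_mul_eq_div, div_le_iff₀ hma]
      linarith
    rw [Nat.cast_sub hW]
    push_cast
    linarith
  calc C * n ^ (-(1 / m2 G))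
      ≤ C ^ H.edgeSet.ncard *
          n ^ (((Fintype.card W - 2 : ℕ) : ℝ) + -(1 / m2a G H) * H.edgeSet.ncard) := by
        refine mul_le_mul (le_self_pow₀ hC he.ne') (Real.rpow_le_rpow_of_exponent_le hn hexp)
          (by positivity) (by positivity)
    _ = n ^ (Fintype.card W - 2) * (C * n ^ (-(1 / m2a G H))) ^ H.edgeSet.ncard := by
        rw [Real.rpow_add hn0, Real.rpow_natCast, Real.rpow_mul hn0.le, Real.rpow_natCast, mul_pow]
        ring
    _ ≤ _ := by gcongr

end Densities

section Counting

variable {V W : Type*} [Fintype V] [Fintype W] {n : ℕ}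

theorem codeg_le_of_forall {ι X γ : Type*} {x : γ → ι → X} {𝓦 : Finset γ} {S : Finset ι}
    {ψ : ι → X} {m : ℕ}
    (h : ∀ 𝓕 : Finset γ, (∀ g ∈ 𝓕, ∀ i ∈ S, x g i = ψ i) → 𝓕.card ≤ m) : codeg x 𝓦 S ψ ≤ m :=
  h _ fun _ hg => (Finset.mem_filter.1 hg).2

theorem codegLE_embeddings (G : SimpleGraph V) (hG : G.edgeSet.Nonempty) (hn : 0 < n) {θ : ℝ}
    (hθ : (n : ℝ) ^ (-(1 / m2 G)) ≤ θ) :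
    CodegLE (fun (g : V ↪ Fin n) (e : G.edgeSet) => Sym2.map g e.1) Finset.univ Finset.univ θ
      (2 ^ Fintype.card V * (n : ℝ) ^ Fintype.card V / (n : ℝ) ^ 2) := by
  intro S _ hSne ψ
  set S' : Finset (Sym2 V) := S.map (Function.Embedding.subtype _) with hS'
  have hS'G : ↑S' ⊆ G.edgeSet := by
    intro e he
    obtain ⟨e', -, rfl⟩ := Finset.mem_map.1 he
    exact e'.2
  have hS'ne : S'.Nonempty := hSne.map
  have hcard : S'.card = S.card := Finset.card_map _
  set T := spanVerts S' with hT
  have hT2 : 2 ≤ T.card := two_le_card_spanVerts hS'G hS'ne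
  have hTV : T.card ≤ Fintype.card V := Finset.card_le_univ T
  have hcount : codeg (fun (g : V ↪ Fin n) (e : G.edgeSet) => Sym2.map g e.1) Finset.univ S ψ ≤
      2 ^ T.card * n ^ (Fintype.card V - T.card) := by
    refine codeg_le_of_forall fun 𝓕 h𝓕 => card_embeddings_le T
      (fun v => Finset.univ.filter fun y => ∀ e ∈ S, v ∈ e.1 → y ∈ ψ e) (fun v hv => ?_) _
      fun g hg v hv => ?_
    · obtain ⟨_, he', hve⟩ := mem_spanVerts.1 hv
      obtain ⟨e, he, rfl⟩ := Finset.mem_map.1 he'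
      refine (Finset.card_le_card (t := (ψ e).toFinset) fun y hy => ?_).trans ?_
      · exact Sym2.mem_toFinset.2 ((Finset.mem_filter.1 hy).2 e he hve)
      · rw [Sym2.card_toFinset]
        split_ifs <;> norm_num
    · refine Finset.mem_filter.2 ⟨Finset.mem_univ _, fun e he hve => ?_⟩
      rw [← h𝓕 g hg e he]
      exact Sym2.mem_map.2 ⟨v, hve, rfl⟩
  have hn1 : (1 : ℝ) ≤ n := by exact_mod_cast hn
  have hpow : 1 ≤ (n : ℝ) ^ (T.card - 2) * θ ^ (S.card - 1) := by
    refine one_le_mul_pow_of_rpow_le hn1 (m2_pos hG) hθ ?_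
    have := card_sub_one_le_m2_mul G hS'G hS'ne (m2_pos hG)
    rw [Nat.cast_sub hT2, Nat.cast_sub hSne.card_pos, ← hcard]
    exact_mod_cast this
  have hsplit : (n : ℝ) ^ Fintype.card V =
      n ^ (Fintype.card V - T.card) * n ^ (T.card - 2) * n ^ 2 := by
    rw [← pow_add, ← pow_add]
    congr 1
    omega
  calc (codeg (fun (g : V ↪ Fin n) (e : G.edgeSet) => Sym2.map g e.1) Finset.univ S ψ : ℝ)
      ≤ 2 ^ T.card * n ^ (Fintype.card V - T.card) := by exact_mod_cast hcount
    _ ≤ 2 ^ Fintype.card V * n ^ (Fintype.card V - T.card) := by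
        gcongr
        norm_num
    _ ≤ 2 ^ Fintype.card V * n ^ (Fintype.card V - T.card) *
          ((n : ℝ) ^ (T.card - 2) * θ ^ (S.card - 1)) :=
        le_mul_of_one_le_right (by positivity) hpow
    _ = _ := by
        rw [hsplit]
        field_simp

/-- The edges of the copy of `H` given by the embedding `h`, as a finset. -/
noncomputable def copyFinset (H : SimpleGraph W) (h : W ↪ Fin n) : Finset (Sym2 (Fin n)) :=
  H.edgeSet.toFinset.image (Sym2.map h)

variable {H : SimpleGraph W}

theorem coe_copyFinset (h : W ↪ Fin n) : (copyFinset H h : Set (Sym2 (Fin n))) = copyEdges H h := by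
  simp [copyFinset, copyEdges]

theorem mem_copyFinset {h : W ↪ Fin n} {f : Sym2 (Fin n)} :
    f ∈ copyFinset H h ↔ ∃ e ∈ H.edgeSet, Sym2.map h e = f := by
  simp [copyFinset]

theorem card_copyFinset (h : W ↪ Fin n) : (copyFinset H h).card = H.edgeSet.ncard := by
  rw [copyFinset, Finset.card_image_of_injective _ (Sym2.map.injective h.injective),
    Set.ncard_eq_toFinset_card']

theorem copyFinset_subset_not_isDiag (h : W ↪ Fin n) :
    copyFinset H h ⊆ Finset.univ.filter fun e : Sym2 (Fin n) => ¬ e.IsDiag := by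
  intro f hf
  obtain ⟨e, he, rfl⟩ := mem_copyFinset.1 hf
  refine Finset.mem_filter.2 ⟨Finset.mem_univ _, ?_⟩
  rw [Sym2.isDiag_map h.injective]
  exact H.not_isDiag_of_mem_edgeSet he

theorem isCopy_fromEdgeSet_iff {S : Finset (Sym2 (Fin n))} {h : W ↪ Fin n} :
    IsCopy H (SimpleGraph.fromEdgeSet (S : Set (Sym2 (Fin n)))) h ↔ copyFinset H h ⊆ S := by
  constructor
  · intro hc f hf
    obtain ⟨e, he, rfl⟩ := mem_copyFinset.1 hf
    induction e with
    | _ u v => exact ((SimpleGraph.fromEdgeSet_adj _).1 (hc he)).1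
  · intro hsub u v huv
    refine (SimpleGraph.fromEdgeSet_adj _).2 ⟨hsub (mem_copyFinset.2 ⟨s(u, v), huv, rfl⟩), ?_⟩
    exact fun heq => H.ne_of_adj huv (h.injective heq)

/-- Few copies of `H` share an edge with a given copy. -/
theorem card_conflicting_le (h₀ : W ↪ Fin n) :
    (Finset.univ.filter fun h : W ↪ Fin n =>
      ¬ Disjoint (copyFinset H h₀) (copyFinset H h)).card ≤
      4 * H.edgeSet.ncard ^ 2 * n ^ (Fintype.card W - 2) := by
  have hsub : (Finset.univ.filter fun h : W ↪ Fin n =>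
      ¬ Disjoint (copyFinset H h₀) (copyFinset H h)) ⊆
      (copyFinset H h₀ ×ˢ H.edgeSet.toFinset).biUnion
        fun z => Finset.univ.filter fun h : W ↪ Fin n => Sym2.map h z.2 = z.1 := by
    intro h hh
    obtain ⟨f, hf, hf'⟩ := Finset.not_disjoint_iff.1 (Finset.mem_filter.1 hh).2
    obtain ⟨e, he, rfl⟩ := mem_copyFinset.1 hf'
    exact Finset.mem_biUnion.2 ⟨(Sym2.map h e, e), by simp [hf, he], by simp⟩
  have hfib : ∀ z ∈ copyFinset H h₀ ×ˢ H.edgeSet.toFinset,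
      (Finset.univ.filter fun h : W ↪ Fin n => Sym2.map h z.2 = z.1).card ≤
        4 * n ^ (Fintype.card W - 2) := by
    rintro ⟨f, e⟩ hz
    have he : e ∈ H.edgeSet := by simpa using (Finset.mem_product.1 hz).2
    have h2 := Sym2.card_toFinset_of_not_isDiag e (H.not_isDiag_of_mem_edgeSet he)
    have := card_embeddings_le (n := n) (s := 2) e.toFinset (fun _ => f.toFinset)
      (fun v _ => by
        rw [Sym2.card_toFinset]
        split_ifs <;> norm_num)
      (Finset.univ.filter fun h : W ↪ Fin n => Sym2.map h e = f) fun h hh v hv => by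
        rw [← (Finset.mem_filter.1 hh).2, Sym2.mem_toFinset]
        exact Sym2.mem_map.2 ⟨v, Sym2.mem_toFinset.1 hv, rfl⟩
    rw [h2] at this
    exact this
  refine (Finset.card_le_card hsub).trans ((Finset.card_biUnion_le_card_mul _ _ _ hfib).trans ?_)
  rw [Finset.card_product, card_copyFinset, ← Set.ncard_eq_toFinset_card']
  exact le_of_eq (by ring)

/-- Conditioned on a copy of `H`, the expected number of copies sharing an edge with it is
bounded. -/
theorem sum_conflicting_le (hm : 0 < mStar H) (hn : 0 < n) {p : ℝ} (hp : 0 ≤ p)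
    (hpn : p ≤ (n : ℝ) ^ (-(1 / mStar H))) (𝓗 : Finset (W ↪ Fin n)) (h₀ : W ↪ Fin n) :
    ∑ h ∈ 𝓗.filter (fun h => ¬ Disjoint (copyFinset H h₀) (copyFinset H h)),
        p ^ (copyFinset H h \ copyFinset H h₀).card ≤
      2 ^ H.edgeSet.ncard * (Fintype.card W : ℝ) ^ Fintype.card W := by
  set 𝓐 := 𝓗.filter (fun h => ¬ Disjoint (copyFinset H h₀) (copyFinset H h)) with h𝓐
  set shared : (W ↪ Fin n) → Finset (Sym2 W) := fun h =>
    H.edgeSet.toFinset.filter fun e => Sym2.map h e ∈ copyFinset H h₀ with hshared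
  have hn1 : (1 : ℝ) ≤ n := by exact_mod_cast hn
  have hcard : ∀ h, (copyFinset H h \ copyFinset H h₀).card =
      H.edgeSet.ncard - (shared h).card := by
    intro h
    have hinter : copyFinset H h ∩ copyFinset H h₀ = (shared h).image (Sym2.map h) := by
      ext f
      simp only [Finset.mem_inter, mem_copyFinset (h := h), Finset.mem_image, hshared,
        Finset.mem_filter, Set.mem_toFinset]
      constructor
      · rintro ⟨⟨e, he, rfl⟩, hf⟩
        exact ⟨e, ⟨he, hf⟩, rfl⟩
      · rintro ⟨e, ⟨he, hf⟩, rfl⟩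
        exact ⟨⟨e, he, rfl⟩, hf⟩
    rw [Finset.card_sdiff, Finset.inter_comm, hinter,
      Finset.card_image_of_injective _ (Sym2.map.injective h.injective), card_copyFinset]
  have hmaps : ∀ h ∈ 𝓐, shared h ∈ H.edgeSet.toFinset.powerset := fun h _ =>
    Finset.mem_powerset.2 (Finset.filter_subset _ _)
  rw [← Finset.sum_fiberwise_of_maps_to hmaps]
  calc ∑ S ∈ H.edgeSet.toFinset.powerset, ∑ h ∈ 𝓐.filter fun h => shared h = S,
        p ^ (copyFinset H h \ copyFinset H h₀).card
      ≤ ∑ S ∈ H.edgeSet.toFinset.powerset, (Fintype.card W : ℝ) ^ Fintype.card W := by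
        refine Finset.sum_le_sum fun S hS => ?_
        rcases (𝓐.filter fun h => shared h = S).eq_empty_or_nonempty with hemp | ⟨h₁, hh₁⟩
        · rw [hemp, Finset.sum_empty]
          positivity
        rw [Finset.mem_filter, h𝓐, Finset.mem_filter] at hh₁
        have hSH : ↑S ⊆ H.edgeSet := fun e he => by
          simpa using Finset.mem_powerset.1 hS he
        have hSne : S.Nonempty := by
          obtain ⟨f, hf, hf'⟩ := Finset.not_disjoint_iff.1 hh₁.1.2
          obtain ⟨e, he, rfl⟩ := mem_copyFinset.1 hf'
          exact ⟨e, by rw [← hh₁.2]; simp [hshared, he, hf]⟩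
        have hcount : (𝓐.filter fun h => shared h = S).card ≤
            Fintype.card W ^ (spanVerts S).card *
              n ^ (Fintype.card W - (spanVerts S).card) := by
          refine card_embeddings_le (spanVerts S) (fun _ => Finset.univ.map h₀)
            (fun _ _ => by simp) _ fun h hh v hv => ?_
          obtain ⟨e, he, hve⟩ := mem_spanVerts.1 hv
          rw [← (Finset.mem_filter.1 hh).2] at he
          obtain ⟨e', -, heq⟩ := mem_copyFinset.1 (Finset.mem_filter.1 he).2
          have hmem : h v ∈ Sym2.map h₀ e' := by
            rw [heq]
            exact Sym2.mem_map.2 ⟨v, hve, rfl⟩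
          obtain ⟨u, -, hu⟩ := Sym2.mem_map.1 hmem
          exact Finset.mem_map.2 ⟨u, Finset.mem_univ _, hu⟩
        have hcW : (1 : ℝ) ≤ Fintype.card W := by
          have h2 := two_le_card_spanVerts hSH hSne
          have h3 := Finset.card_le_univ (spanVerts S)
          exact_mod_cast (by omega : 1 ≤ Fintype.card W)
        calc ∑ h ∈ 𝓐.filter fun h => shared h = S, p ^ (copyFinset H h \ copyFinset H h₀).card
            = (𝓐.filter fun h => shared h = S).card * p ^ (H.edgeSet.ncard - S.card) := by
              rw [← nsmul_eq_mul, ← Finset.sum_const]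
              refine Finset.sum_congr rfl fun h hh => ?_
              rw [hcard, (Finset.mem_filter.1 hh).2]
          _ ≤ ((Fintype.card W : ℝ) ^ (spanVerts S).card *
                (n : ℝ) ^ (Fintype.card W - (spanVerts S).card)) *
                  p ^ (H.edgeSet.ncard - S.card) := by
              refine mul_le_mul_of_nonneg_right ?_ (by positivity)
              exact_mod_cast hcount
          _ = (Fintype.card W : ℝ) ^ (spanVerts S).card *
                ((n : ℝ) ^ (Fintype.card W - (spanVerts S).card) *
                  p ^ (H.edgeSet.ncard - S.card)) := by ring
          _ ≤ (Fintype.card W : ℝ) ^ Fintype.card W * 1 := by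
              refine mul_le_mul (pow_le_pow_right₀ hcW (Finset.card_le_univ _))
                (pow_card_sub_mul_pow_le_one H hm hn1 hp hpn hSH hSne) (by positivity)
                (by positivity)
          _ = _ := mul_one _
    _ = _ := by
        rw [Finset.sum_const, Finset.card_powerset, ← Set.ncard_eq_toFinset_card', nsmul_eq_mul]
        push_cast
        rfl

end Counting

section UnionBound

theorem Captures.pairwise_fst {X Ω : Type*} {root : Ω → X} {conf : Ω → Ω → Prop} {I : Finset Ω}
    {z : Finset Ω × Finset X} (hz : Captures root conf I ∅ z) :
    (z.1 : Set Ω).Pairwise fun ω ω' => ¬ conf ω ω' := by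
  have := hz.pairwise
  rwa [Finset.empty_union] at this

theorem Captures.exists_conf {X Ω : Type*} {root : Ω → X} {conf : Ω → Ω → Prop} {I : Finset Ω}
    {z : Finset Ω × Finset X} (hz : Captures root conf I ∅ z) {ω : Ω} (hω : ω ∈ I)
    (hr : root ω ∈ z.2) : ∃ ω' ∈ z.1, conf ω ω' := by
  have := hz.conflict ω hω hr
  rwa [Finset.empty_union] at this

theorem spansFew_of_forall {ι X Ω γ : Type*} {x : γ → ι → X} {root : Ω → X}
    {conf : Ω → Ω → Prop} {𝓦 : Finset γ} {I : Finset Ω} {M : ℝ}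
    (h : ∀ T ⊆ I, (T : Set Ω).Pairwise (fun ω ω' => ¬ conf ω ω') →
      ∀ 𝓕 : Finset γ, (∀ g ∈ 𝓕, ∀ i, ∃ ω ∈ T, root ω = x g i) → (𝓕.card : ℝ) < M) :
    SpansFew x root conf 𝓦 I M := fun T hT hpair => h T hT hpair _ fun _ hg i =>
  Finset.mem_image.1 ((Finset.mem_filter.1 hg).2 i)

theorem expect_contain_avoid_le {α τ : Type*} {U : Finset α} {p : ℝ} {D : τ → Finset α}
    (hp₀ : 0 ≤ p) (hp₁ : p ≤ 1) (𝓗 : Finset τ) (m : ℕ) (hDU : ∀ h, D h ⊆ U)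
    (hDm : ∀ h, (D h).card = m) {K : ℝ} (hK1 : 1 ≤ K)
    (hK : ∀ h₀, ∑ h ∈ 𝓗.filter (fun h => ¬ Disjoint (D h₀) (D h)), p ^ (D h \ D h₀).card ≤ K)
    {B : Finset α} (hB : B ⊆ U) {P : Finset α → Prop}
    (hP : ∀ S, P S ↔ B ⊆ S ∧ ¬ ∃ h ∈ 𝓗, D h ⊆ S) :
    expect U p (fun S => if P S then 1 else 0) ≤
      p ^ B.card * Real.exp (-(𝓗.card * p ^ m / (4 * K))) := by
  have hanti : Antitone fun S : Finset α => if ∃ h ∈ 𝓗, D h ⊆ S then (0 : ℝ) else 1 := by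
    intro S S' hSS'
    by_cases h : ∃ h ∈ 𝓗, D h ⊆ S
    · obtain ⟨j, hj, hjS⟩ := h
      exact (if_pos (⟨j, hj, hjS.trans hSS'⟩ : ∃ h ∈ 𝓗, D h ⊆ S')).trans_le (by positivity)
    · simp only [if_neg h]
      split_ifs <;> norm_num
  calc expect U p (fun S => if P S then 1 else 0)
      = expect U p (fun S => (if B ⊆ S then 1 else 0) *
          if ∃ h ∈ 𝓗, D h ⊆ S then 0 else 1) := by
        congr 1
        funext S
        by_cases h1 : B ⊆ S <;> by_cases h2 : ∃ h ∈ 𝓗, D h ⊆ S <;> simp [hP S, h1, h2]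
    _ ≤ p ^ B.card * expect U p (fun S => if ∃ h ∈ 𝓗, D h ⊆ S then 0 else 1) :=
        expect_indicator_subset_le hp₀ hp₁ hB hanti
    _ ≤ _ := mul_le_mul_of_nonneg_left
        (expect_no_subset_le_exp hp₀ hp₁ 𝓗 m hDU hDm hK1 hK) (by positivity)

/-- The potential edges of a graph on `Fin n`. -/
noncomputable def pairs (n : ℕ) : Finset (Sym2 (Fin n)) :=
  Finset.univ.filter fun e => ¬ e.IsDiag

theorem card_pairs (n : ℕ) : (pairs n).card = n.choose 2 := by
  have h := Sym2.card_subtype_not_diag (α := Fin n)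
  rw [Fintype.card_fin, Fintype.card_subtype] at h
  rw [← h, pairs]

theorem one_sub_le_gnpProb {n : ℕ} {p δ : ℝ} {A : SimpleGraph (Fin n) → Prop}
    (h : expect (pairs n) p (fun S => if A (SimpleGraph.fromEdgeSet ↑S) then 0 else 1) ≤ δ) :
    1 - δ ≤ gnpProb n p A := by
  have heq : gnpProb n p A =
      expect (pairs n) p (fun S => 1 - if A (SimpleGraph.fromEdgeSet ↑S) then (0 : ℝ) else 1) := by
    unfold gnpProb expect
    rw [card_pairs]
    refine Finset.sum_congr rfl fun S _ => ?_
    by_cases hA : A (SimpleGraph.fromEdgeSet ↑S) <;> simp [hA]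
  rw [heq, expect_sub, expect_one]
  linarith

variable {V W : Type*} [Fintype W] {n : ℕ} {G : SimpleGraph V} {H : SimpleGraph W}

/-- The distinguished edge of a copy of `H` with a distinguished edge. -/
def rootEdge (ω : (W ↪ Fin n) × H.edgeSet) : Sym2 (Fin n) :=
  Sym2.map ω.1 ω.2.1

/-- Two copies of `H` share an edge. -/
def ShareEdge (ω ω' : (W ↪ Fin n) × H.edgeSet) : Prop :=
  ¬ Disjoint (copyFinset H ω.1) (copyFinset H ω'.1)

theorem rootEdge_mem (ω : (W ↪ Fin n) × H.edgeSet) : rootEdge ω ∈ copyFinset H ω.1 :=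
  mem_copyFinset.2 ⟨ω.2.1, ω.2.2, rfl⟩

theorem ShareEdge.symm {ω ω' : (W ↪ Fin n) × H.edgeSet} (h : ShareEdge ω ω') : ShareEdge ω' ω :=
  fun hd => h hd.symm

theorem ShareEdge.of_rootEdge_eq {ω ω' : (W ↪ Fin n) × H.edgeSet} (h : rootEdge ω = rootEdge ω') :
    ShareEdge ω ω' :=
  Finset.not_disjoint_iff.2 ⟨rootEdge ω, rootEdge_mem ω, by
    rw [h]
    exact rootEdge_mem _⟩

/-- The copies of `H` in `S` rooted at a red edge. -/
noncomputable def redRooted (H : SimpleGraph W) (S : Finset (Sym2 (Fin n)))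
    (c : Sym2 (Fin n) → Bool) : Finset ((W ↪ Fin n) × H.edgeSet) :=
  Finset.univ.filter fun ω => copyFinset H ω.1 ⊆ S ∧ c (rootEdge ω) = true

/-- The `H`-covered red copies of `G`. -/
def coveredRed (G : SimpleGraph V) (H : SimpleGraph W) (F : SimpleGraph (Fin n))
    (c : Sym2 (Fin n) → Bool) : Set (V ↪ Fin n) :=
  {g | (∀ e ∈ G.edgeSet, Sym2.map (⇑g) e ∈ HEdges H F ∧ c (Sym2.map (⇑g) e) = true) ∧
    ∃ φ : G.edgeSet → (W ↪ Fin n),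
      (∀ e : G.edgeSet, IsCopy H F (φ e)) ∧
      (∀ e e' : G.edgeSet, e ≠ e' → Disjoint (copyEdges H (φ e)) (copyEdges H (φ e'))) ∧
      ∀ e : G.edgeSet, Sym2.map (⇑g) e.1 ∈ copyEdges H (φ e)}

theorem mem_coveredRed {S : Finset (Sym2 (Fin n))} {c : Sym2 (Fin n) → Bool}
    {T : Finset ((W ↪ Fin n) × H.edgeSet)} (hT : T ⊆ redRooted H S c)
    (hpair : (T : Set ((W ↪ Fin n) × H.edgeSet)).Pairwise fun ω ω' => ¬ ShareEdge ω ω')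
    {g : V ↪ Fin n} (hg : ∀ e : G.edgeSet, ∃ ω ∈ T, rootEdge ω = Sym2.map g e.1) :
    g ∈ coveredRed G H (SimpleGraph.fromEdgeSet ↑S) c := by
  choose ω hωT hω using hg
  have hprop : ∀ e, copyFinset H (ω e).1 ⊆ S ∧ c (rootEdge (ω e)) = true := fun e =>
    (Finset.mem_filter.1 (hT (hωT e))).2
  have hcopy : ∀ e, IsCopy H (SimpleGraph.fromEdgeSet (S : Set (Sym2 (Fin n)))) (ω e).1 :=
    fun e => isCopy_fromEdgeSet_iff.2 (hprop e).1
  have hmem : ∀ e, Sym2.map g e.1 ∈ copyEdges H (ω e).1 := fun e => by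
    rw [← coe_copyFinset, Finset.mem_coe, ← hω e]
    exact rootEdge_mem _
  refine ⟨fun e he => ⟨?_, ?_⟩, fun e => (ω e).1, hcopy, fun e e' hne => ?_, hmem⟩
  · exact Set.mem_iUnion₂.2 ⟨(ω ⟨e, he⟩).1, hcopy ⟨e, he⟩, hmem ⟨e, he⟩⟩
  · rw [← hω ⟨e, he⟩]
    exact (hprop ⟨e, he⟩).2
  · have hωne : ω e ≠ ω e' := fun heq => hne (Subtype.ext (Sym2.map.injective g.injective (by
      rw [← hω e, ← hω e', heq])))
    have hdis := not_not.1 (hpair (hωT e) (hωT e') hωne)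
    rw [← coe_copyFinset, ← coe_copyFinset]
    exact Finset.disjoint_coe.2 hdis

theorem spansFew_of_ncard_lt [Fintype V] {S : Finset (Sym2 (Fin n))} {c : Sym2 (Fin n) → Bool}
    {M : ℝ}
    (h : ((coveredRed G H (SimpleGraph.fromEdgeSet ↑S) c).ncard : ℝ) < M) :
    SpansFew (fun (g : V ↪ Fin n) (e : G.edgeSet) => Sym2.map g e.1) rootEdge ShareEdge
      Finset.univ (redRooted H S c) M := by
  refine spansFew_of_forall fun T hT hpair 𝓕 h𝓕 => lt_of_le_of_lt ?_ h
  rw [← Set.ncard_coe_finset]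
  exact Nat.cast_le.2 (Set.ncard_le_ncard (fun g hg => mem_coveredRed hT hpair (h𝓕 g hg))
    (Set.toFinite _))

/-- The copies of `H` inside the container of `z` that avoid the edges of its fingerprint. -/
noncomputable def freeCopies (z : Finset ((W ↪ Fin n) × H.edgeSet) × Finset (Sym2 (Fin n))) :
    Finset (W ↪ Fin n) :=
  Finset.univ.filter fun h => (∀ e ∈ H.edgeSet, Sym2.map h e ∈ z.2) ∧
    ∀ ω ∈ z.1, Disjoint (copyFinset H ω.1) (copyFinset H h)

/-- `S` contains the fingerprint of `z` and no free copy of `H` in its container. -/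
def Consistent (z : Finset ((W ↪ Fin n) × H.edgeSet) × Finset (Sym2 (Fin n)))
    (S : Finset (Sym2 (Fin n))) : Prop :=
  (z.1 : Set ((W ↪ Fin n) × H.edgeSet)).Pairwise (fun ω ω' => ¬ ShareEdge ω ω') ∧
    (z.1.biUnion fun ω => copyFinset H ω.1) ⊆ S ∧ ¬ ∃ h ∈ freeCopies z, copyFinset H h ⊆ S

theorem Consistent.of_captures {S : Finset (Sym2 (Fin n))} {c : Sym2 (Fin n) → Bool}
    {z : Finset ((W ↪ Fin n) × H.edgeSet) × Finset (Sym2 (Fin n))}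
    (hblue : ¬ ∃ f : W ↪ Fin n, IsCopy H (SimpleGraph.fromEdgeSet (S : Set (Sym2 (Fin n)))) f ∧
      ∀ e ∈ H.edgeSet, c (Sym2.map (⇑f) e) = false)
    (hz : Captures rootEdge ShareEdge (redRooted H S c) ∅ z) : Consistent z S := by
  refine ⟨hz.pairwise_fst, ?_, ?_⟩
  · exact Finset.biUnion_subset.2 fun ω hω => (Finset.mem_filter.1 (hz.subset hω)).2.1
  · rintro ⟨h, hh, hS⟩
    obtain ⟨hcont, hdis⟩ := (Finset.mem_filter.1 hh).2
    refine hblue ⟨h, isCopy_fromEdgeSet_iff.2 hS, fun e he => ?_⟩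
    by_contra hne
    rw [Bool.not_eq_false] at hne
    obtain ⟨ω, hω, hshare⟩ := hz.exists_conf (ω := (h, ⟨e, he⟩))
      (Finset.mem_filter.2 ⟨Finset.mem_univ _, hS, hne⟩) (hcont e he)
    exact hshare (hdis ω hω).symm

theorem card_le_card_freeCopies_add
    (z : Finset ((W ↪ Fin n) × H.edgeSet) × Finset (Sym2 (Fin n))) :
    (Finset.univ.filter fun h : W ↪ Fin n => ∀ e ∈ H.edgeSet, Sym2.map h e ∈ z.2).card ≤
      (freeCopies z).card +
        z.1.card * (4 * H.edgeSet.ncard ^ 2 * n ^ (Fintype.card W - 2)) := by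
  have hsub : (Finset.univ.filter fun h : W ↪ Fin n => ∀ e ∈ H.edgeSet, Sym2.map h e ∈ z.2) ⊆
      freeCopies z ∪ z.1.biUnion fun ω => Finset.univ.filter fun h : W ↪ Fin n =>
        ¬ Disjoint (copyFinset H ω.1) (copyFinset H h) := by
    intro h hh
    by_cases hd : ∀ ω ∈ z.1, Disjoint (copyFinset H ω.1) (copyFinset H h)
    · exact Finset.mem_union_left _
        (Finset.mem_filter.2 ⟨Finset.mem_univ _, (Finset.mem_filter.1 hh).2, hd⟩)
    · push Not at hd
      obtain ⟨ω, hω, hdis⟩ := hd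
      exact Finset.mem_union_right _ (Finset.mem_biUnion.2
        ⟨ω, hω, Finset.mem_filter.2 ⟨Finset.mem_univ _, hdis⟩⟩)
  refine (Finset.card_le_card hsub).trans ((Finset.card_union_le _ _).trans ?_)
  exact Nat.add_le_add_left
    (Finset.card_biUnion_le_card_mul _ _ _ fun ω _ => card_conflicting_le ω.1) _

/-- The Janson constant of `H`. -/
noncomputable def jansonConst (H : SimpleGraph W) : ℝ :=
  2 ^ H.edgeSet.ncard * (Fintype.card W : ℝ) ^ Fintype.card W

theorem one_le_jansonConst (H : SimpleGraph W) (hW : 0 < Fintype.card W) : 1 ≤ jansonConst H := by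
  have : (1 : ℝ) ≤ Fintype.card W := by exact_mod_cast hW
  exact one_le_mul_of_one_le_of_one_le (one_le_pow₀ (by norm_num)) (one_le_pow₀ this)

theorem half_mul_le_card_freeCopies (hW : 2 ≤ Fintype.card W) {δ : ℝ}
    (z : Finset ((W ↪ Fin n) × H.edgeSet) × Finset (Sym2 (Fin n)))
    (hz : δ * (n : ℝ) ^ Fintype.card W ≤
      ((Finset.univ.filter fun h : W ↪ Fin n => ∀ e ∈ H.edgeSet, Sym2.map h e ∈ z.2).card : ℝ))
    (hsmall : (z.1.card : ℝ) * (4 * H.edgeSet.ncard ^ 2) ≤ δ / 2 * (n : ℝ) ^ 2) :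
    δ / 2 * (n : ℝ) ^ Fintype.card W ≤ (freeCopies z).card := by
  have h1 : (((Finset.univ.filter fun h : W ↪ Fin n =>
      ∀ e ∈ H.edgeSet, Sym2.map h e ∈ z.2).card : ℕ) : ℝ) ≤ (freeCopies z).card +
      z.1.card * (4 * H.edgeSet.ncard ^ 2 * (n : ℝ) ^ (Fintype.card W - 2)) := by
    exact_mod_cast card_le_card_freeCopies_add z
  have h2 := mul_le_mul_of_nonneg_right hsmall
    (by positivity : (0 : ℝ) ≤ (n : ℝ) ^ (Fintype.card W - 2))
  have h3 : (n : ℝ) ^ Fintype.card W = (n : ℝ) ^ 2 * (n : ℝ) ^ (Fintype.card W - 2) := by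
    rw [← pow_add]
    congr 1
    omega
  rw [h3] at hz ⊢
  linarith

theorem expect_consistent_le (hm : 0 < mStar H) (hn : 0 < n) (hW : 2 ≤ Fintype.card W) {p δ : ℝ}
    (hp₀ : 0 ≤ p) (hp₁ : p ≤ 1) (hpn : p ≤ (n : ℝ) ^ (-(1 / mStar H)))
    (z : Finset ((W ↪ Fin n) × H.edgeSet) × Finset (Sym2 (Fin n)))
    (hz : δ * (n : ℝ) ^ Fintype.card W ≤
      ((Finset.univ.filter fun h : W ↪ Fin n => ∀ e ∈ H.edgeSet, Sym2.map h e ∈ z.2).card : ℝ))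
    (hsmall : (z.1.card : ℝ) * (4 * H.edgeSet.ncard ^ 2) ≤ δ / 2 * (n : ℝ) ^ 2) :
    expect (pairs n) p (fun S => if Consistent z S then 1 else 0) ≤
      (p ^ H.edgeSet.ncard) ^ z.1.card *
        Real.exp (-(δ / (8 * jansonConst H) *
          ((n : ℝ) ^ Fintype.card W * p ^ H.edgeSet.ncard))) := by
  have hK := one_le_jansonConst H (by omega)
  by_cases hpair : (z.1 : Set ((W ↪ Fin n) × H.edgeSet)).Pairwise (fun ω ω' => ¬ ShareEdge ω ω')
  swap
  · have hzero : (fun S => if Consistent z S then (1 : ℝ) else 0) = fun _ => 0 := by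
      funext S
      rw [if_neg fun h => hpair h.1]
    rw [hzero]
    simp only [expect, mul_zero, Finset.sum_const_zero]
    positivity
  have hcardD : (z.1.biUnion fun ω => copyFinset H ω.1).card = H.edgeSet.ncard * z.1.card := by
    rw [Finset.card_biUnion fun ω hω ω' hω' hne => not_not.1 (hpair hω hω' hne),
      Finset.sum_const_nat fun ω _ => card_copyFinset ω.1, mul_comm]
  have hfree := half_mul_le_card_freeCopies hW z hz hsmall
  calc expect (pairs n) p (fun S => if Consistent z S then 1 else 0)
      ≤ p ^ (z.1.biUnion fun ω => copyFinset H ω.1).card *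
          Real.exp (-((freeCopies z).card * p ^ H.edgeSet.ncard / (4 * jansonConst H))) := by
        refine expect_contain_avoid_le hp₀ hp₁ (freeCopies z) H.edgeSet.ncard
          copyFinset_subset_not_isDiag card_copyFinset hK (fun h₀ => ?_)
          (Finset.biUnion_subset.2 fun ω _ => copyFinset_subset_not_isDiag ω.1)
          fun S => ⟨And.right, And.intro hpair⟩
        rw [jansonConst]
        convert sum_conflicting_le hm hn hp₀ hpn (freeCopies z) h₀
    _ ≤ _ := by
        rw [hcardD, pow_mul]
        refine mul_le_mul_of_nonneg_left (Real.exp_le_exp.2 (neg_le_neg ?_)) (by positivity)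
        have hfree' := mul_le_mul_of_nonneg_right hfree
          (by positivity : 0 ≤ p ^ H.edgeSet.ncard)
        rw [le_div_iff₀ (by positivity)]
        calc _ = δ / 2 * (n : ℝ) ^ Fintype.card W * p ^ H.edgeSet.ncard := by
              field_simp
              ring
          _ ≤ _ := hfree'

theorem expect_exists_consistent_le (hm : 0 < mStar H) (hn : 0 < n) (hW : 2 ≤ Fintype.card W)
    {p δ : ℝ} (hp₀ : 0 ≤ p) (hp₁ : p ≤ 1) (hpn : p ≤ (n : ℝ) ^ (-(1 / mStar H)))
    (𝒵 : Finset (Finset ((W ↪ Fin n) × H.edgeSet) × Finset (Sym2 (Fin n))))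
    (hz : ∀ z ∈ 𝒵, δ * (n : ℝ) ^ Fintype.card W ≤
      ((Finset.univ.filter fun h : W ↪ Fin n => ∀ e ∈ H.edgeSet, Sym2.map h e ∈ z.2).card : ℝ))
    (hsmall : ∀ z ∈ 𝒵, (z.1.card : ℝ) * (4 * H.edgeSet.ncard ^ 2) ≤ δ / 2 * (n : ℝ) ^ 2) :
    expect (pairs n) p (fun S => if ∃ z ∈ 𝒵, Consistent z S then 1 else 0) ≤
      (∑ z ∈ 𝒵, (p ^ H.edgeSet.ncard) ^ z.1.card) *
        Real.exp (-(δ / (8 * jansonConst H) *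
          ((n : ℝ) ^ Fintype.card W * p ^ H.edgeSet.ncard))) := by
  calc expect (pairs n) p (fun S => if ∃ z ∈ 𝒵, Consistent z S then 1 else 0)
      ≤ expect (pairs n) p (fun S => ∑ z ∈ 𝒵, if Consistent z S then 1 else 0) := by
        refine expect_mono hp₀ hp₁ fun S _ => ?_
        split_ifs with h
        · obtain ⟨z, hz𝒵, hzS⟩ := h
          refine le_trans (by rw [if_pos hzS]) (Finset.single_le_sum
            (f := fun z => if Consistent z S then (1 : ℝ) else 0) (fun z _ => ?_) hz𝒵)
          positivity
        · exact Finset.sum_nonneg fun z _ => by positivity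
    _ = ∑ z ∈ 𝒵, expect (pairs n) p (fun S => if Consistent z S then 1 else 0) :=
        expect_sum 𝒵 _
    _ ≤ _ := by
        rw [Finset.sum_mul]
        exact Finset.sum_le_sum fun z hz𝒵 =>
          expect_consistent_le hm hn hW hp₀ hp₁ hpn z (hz z hz𝒵) (hsmall z hz𝒵)

end UnionBound

section Assembly

variable {V : Type u₁} {W : Type u₂} [Fintype V] [Fintype W]

theorem card_sym2_fin_le (n : ℕ) : (Fintype.card (Sym2 (Fin n)) : ℝ) ≤ (n : ℝ) ^ 2 := by
  rw [Sym2.card, Fintype.card_fin, Nat.choose_two_right, Nat.add_sub_cancel]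
  have h : (n + 1) * n / 2 ≤ n ^ 2 := by
    refine Nat.div_le_of_le_mul ?_
    nlinarith [Nat.le_self_pow two_ne_zero n]
  exact_mod_cast h

theorem card_rooted_le (H : SimpleGraph W) (n : ℕ) :
    (Fintype.card ((W ↪ Fin n) × H.edgeSet) : ℝ) ≤
      H.edgeSet.ncard * (n : ℝ) ^ Fintype.card W := by
  have h : Fintype.card ((W ↪ Fin n) × H.edgeSet) ≤ H.edgeSet.ncard * n ^ Fintype.card W := by
    rw [Fintype.card_prod, mul_comm, ← Nat.card_eq_fintype_card (α := H.edgeSet),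
      Nat.card_coe_set_eq, Fintype.card_embedding_eq, Fintype.card_fin]
    exact Nat.mul_le_mul_left _ (Nat.descFactorial_le_pow _ _)
  exact_mod_cast h

/-- Containers for the colorings with few covered red copies of `G`. -/
theorem exists_coloring_containers (G : SimpleGraph V) (H : SimpleGraph W)
    (hG : G.edgeSet.Nonempty) {ε : ℝ} (hε : 0 < ε) :
    ∃ (L : ℕ) (a : ℝ), 0 < L ∧ 0 < a ∧ ∀ (n : ℕ) (θ t : ℝ) (b : ℕ), 0 < n →
      (n : ℝ) ^ (-(1 / m2 G)) ≤ θ → 0 ≤ t → (b : ℝ) = θ * (n : ℝ) ^ 2 →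
      ∃ 𝒵 : Finset (Finset ((W ↪ Fin n) × H.edgeSet) × Finset (Sym2 (Fin n))),
        ∑ z ∈ 𝒵, t ^ z.1.card ≤
          smallSetSum ((W ↪ Fin n) × H.edgeSet) t b ^ (L * G.edgeSet.ncard) ∧
        (∀ z ∈ 𝒵, z.1.card ≤ L * G.edgeSet.ncard * b) ∧
        (∀ z ∈ 𝒵, ((Finset.univ.filter fun g : V ↪ Fin n =>
          ∀ e ∈ G.edgeSet, Sym2.map g e ∉ z.2).card : ℝ) < ε * (n : ℝ) ^ Fintype.card V) ∧
        ∀ (S : Finset (Sym2 (Fin n))) (c : Sym2 (Fin n) → Bool),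
          (¬ ∃ f : W ↪ Fin n, IsCopy H (SimpleGraph.fromEdgeSet (S : Set (Sym2 (Fin n)))) f ∧
            ∀ e ∈ H.edgeSet, c (Sym2.map (⇑f) e) = false) →
          ((coveredRed G H (SimpleGraph.fromEdgeSet ↑S) c).ncard : ℝ) <
            a * θ ^ G.edgeSet.ncard * (n : ℝ) ^ Fintype.card V →
          ∃ z ∈ 𝒵, Consistent z S := by
  obtain ⟨L, a, hL, ha, key⟩ := exists_container_family.{u₁, 0, u₂, u₁} G.edgeSet.ncard ε
    (2 ^ Fintype.card V) hε (by positivity)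
  refine ⟨L, a, hL, ha, fun n θ t b hn hθ ht hb => ?_⟩
  have hn' : (0 : ℝ) < n := by exact_mod_cast hn
  obtain ⟨𝒵, hsum, hz, hcap⟩ := key
    (fun (g : V ↪ Fin n) (e : G.edgeSet) => Sym2.map g e.1)
    (rootEdge : (W ↪ Fin n) × H.edgeSet → _) ShareEdge
    (fun _ _ => ShareEdge.symm) (fun _ _ => ShareEdge.of_rootEdge_eq) θ ((n : ℝ) ^ 2)
    ((n : ℝ) ^ Fintype.card V) t b
    (by rw [← Nat.card_eq_fintype_card, Nat.card_coe_set_eq])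
    (lt_of_lt_of_le (by positivity) hθ) (by positivity) (by positivity) ht hb
    (card_sym2_fin_le n) (codegLE_embeddings G hG hn hθ)
  refine ⟨𝒵, hsum, fun z hz𝒵 => (hz z hz𝒵).1, fun z hz𝒵 => ?_,
    fun S c hblue hfew => ?_⟩
  · convert (hz z hz𝒵).2 using 4 with g
    exact ⟨fun h e => h e.1 e.2, fun h e he => h ⟨e, he⟩⟩
  · obtain ⟨z, hz𝒵, hzc⟩ := hcap _ (spansFew_of_ncard_lt hfew)
    exact ⟨z, hz𝒵, Consistent.of_captures hblue hzc⟩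

theorem pow_mul_pow_le_one {H : SimpleGraph W} (hH : H.edgeSet.Nonempty) (hm : 0 < mStar H)
    {n p : ℝ} (hn : 1 ≤ n) (hp₀ : 0 ≤ p) (hp₁ : p ≤ 1) (hpn : p ≤ n ^ (-(1 / mStar H))) :
    n ^ (Fintype.card W - 2) * p ^ H.edgeSet.ncard ≤ 1 := by
  obtain ⟨e, he⟩ := hH
  have h := pow_card_sub_mul_pow_le_one H hm hn hp₀ hpn (S := {e}) (by simpa using he) (by simp)
  have hspan : (spanVerts {e}).card = 2 := by
    rw [spanVerts, Finset.singleton_biUnion]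
    exact Sym2.card_toFinset_of_not_isDiag e (H.not_isDiag_of_mem_edgeSet he)
  rw [hspan, Finset.card_singleton] at h
  refine le_trans (mul_le_mul_of_nonneg_left ?_ (by positivity)) h
  exact pow_le_pow_of_le_one hp₀ hp₁ (Nat.sub_le _ _)

theorem one_le_rpow_mul_sq {G : SimpleGraph V} (hG : G.edgeSet.Nonempty) {n : ℝ} (hn : 1 ≤ n) :
    1 ≤ n ^ (-(1 / m2 G)) * n ^ 2 := by
  have hn0 : 0 < n := by linarith
  rw [← Real.rpow_natCast n 2, ← Real.rpow_add hn0]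
  refine Real.one_le_rpow hn ?_
  have h := one_div_le_one_div_of_le (by norm_num) (half_le_m2 hG)
  norm_num at h ⊢
  linarith

theorem smallSetSum_pow_mul_exp_le {Ω : Type*} [Fintype Ω] {t lam c μ e : ℝ} {b K : ℕ}
    (ht : 0 ≤ t) (hl₀ : 0 < lam) (hl₁ : lam ≤ 1) (hμ : 0 ≤ μ)
    (hΩ : Fintype.card Ω * t ≤ e * μ) (hlam : K * (lam * e) ≤ c / 4)
    (hb : K * (b * Real.log (1 / lam)) ≤ c / 4 * μ) :
    smallSetSum Ω t b ^ K * Real.exp (-(c * μ)) ≤ Real.exp (-(c / 2 * μ)) := by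
  have hS := (one_le_smallSetSum Ω ht b).trans' zero_le_one
  calc smallSetSum Ω t b ^ K * Real.exp (-(c * μ))
      ≤ Real.exp (b * Real.log (1 / lam) + lam * (Fintype.card Ω * t)) ^ K *
          Real.exp (-(c * μ)) := by
        gcongr
        exact smallSetSum_le Ω ht hl₀ hl₁ b
    _ = Real.exp (K * (b * Real.log (1 / lam)) + K * (lam * (Fintype.card Ω * t)) - c * μ) := by
        rw [← Real.exp_nat_mul, ← Real.exp_add]
        congr 1
        ring
    _ ≤ _ := by
        refine Real.exp_le_exp.2 ?_
        have h1 : K * (lam * (Fintype.card Ω * t)) ≤ K * (lam * (e * μ)) := by gcongr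
        have h2 := mul_le_mul_of_nonneg_right hlam hμ
        nlinarith

theorem exists_small_parameters {K c ε e : ℝ} (hK : 0 < K) (hc : 0 < c) (hε : 0 < ε)
    (he : 0 < e) : ∃ lam η : ℝ, 0 < lam ∧ lam ≤ 1 ∧ 0 < η ∧ K * (lam * e) ≤ c / 4 ∧
      K * (η * Real.log (1 / lam)) ≤ c / 4 ∧ K * η * (4 * e ^ 2) ≤ ε / 2 := by
  obtain ⟨lam, hlam₀, hlam₁, hlam⟩ : ∃ lam : ℝ, 0 < lam ∧ lam ≤ 1 ∧ lam ≤ c / (4 * K * e) :=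
    ⟨min 1 (c / (4 * K * e)), by positivity, min_le_left _ _, min_le_right _ _⟩
  have hlog : 0 ≤ Real.log (1 / lam) := Real.log_nonneg ((one_le_div hlam₀).2 hlam₁)
  obtain ⟨η, hη₀, hη₁, hη₂⟩ : ∃ η : ℝ, 0 < η ∧ η ≤ c / (4 * K * (Real.log (1 / lam) + 1)) ∧
      η ≤ ε / (8 * K * e ^ 2) :=
    ⟨min (c / (4 * K * (Real.log (1 / lam) + 1))) (ε / (8 * K * e ^ 2)), by positivity,
      min_le_left _ _, min_le_right _ _⟩
  rw [le_div_iff₀ (by positivity)] at hlam hη₁ hη₂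
  have hKη := mul_pos hK hη₀
  exact ⟨lam, η, hlam₀, hlam₁, hη₀, by linarith, by nlinarith, by linarith⟩

theorem exp_neg_le_two_rpow_neg {x : ℝ} (hx : 0 ≤ x) : Real.exp (-x) ≤ 2 ^ (-x) := by
  rw [Real.rpow_def_of_pos two_pos]
  refine Real.exp_le_exp.2 ?_
  nlinarith [Real.log_two_lt_d9]

end Assembly

/-- Main lemma, Lemma 12: if `H` is nonempty with `v_H ≥ 3` and `G` is
nonempty with `m₂(G) < x*(H)`, then there are positive constants `a, b, C, n₀` such that for
`n ≥ n₀` and `C·n^{-1/m₂(G,H)} ≤ p ≤ n^{-1/m*(H)}`, with probability at least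
`1 - 2^{-b·n^{v_H}·p^{e_H}}`, every red-blue coloring of the `H`-edges of `G_{n,p}` with no
blue copy of `H` contains at least `a·n^{v_G}·(n^{v_H-2}·p^{e_H})^{e_G}` `H`-covered red
copies of `G`. -/
theorem stmt4 {V W : Type*} [Fintype V] [Fintype W]
    (G : SimpleGraph V) (H : SimpleGraph W)
    (hHne : H.edgeSet.Nonempty) (hW : 3 ≤ Fintype.card W)
    (hGne : G.edgeSet.Nonempty) (hx : m2 G < xStar H) :
    ∃ a b C : ℝ, ∃ n₀ : ℕ, 0 < a ∧ 0 < b ∧ 0 < C ∧ 0 < n₀ ∧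
      ∀ n : ℕ, n₀ ≤ n → ∀ p : ℝ,
        C * (n : ℝ) ^ (-(1 / m2a G H)) ≤ p → p ≤ (n : ℝ) ^ (-(1 / mStar H)) →
        1 - (2 : ℝ) ^ (-(b * (n : ℝ) ^ (Fintype.card W) * p ^ H.edgeSet.ncard)) ≤
          gnpProb n p (fun F =>
            ∀ c : Sym2 (Fin n) → Bool,
              (¬ ∃ f : W ↪ Fin n, IsCopy H F f ∧
                  ∀ e ∈ H.edgeSet, c (Sym2.map (⇑f) e) = false) →
              a * (n : ℝ) ^ (Fintype.card V) *
                  ((n : ℝ) ^ (Fintype.card W - 2) * p ^ H.edgeSet.ncard) ^ G.edgeSet.ncard ≤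
                ({g : V ↪ Fin n |
                    (∀ e ∈ G.edgeSet, Sym2.map (⇑g) e ∈ HEdges H F ∧
                      c (Sym2.map (⇑g) e) = true) ∧
                    ∃ φ : G.edgeSet → (W ↪ Fin n),
                      (∀ e : G.edgeSet, IsCopy H F (φ e)) ∧
                      (∀ e e' : G.edgeSet, e ≠ e' →
                        Disjoint (copyEdges H (φ e)) (copyEdges H (φ e'))) ∧
                      ∀ e : G.edgeSet, Sym2.map (⇑g) e.1 ∈ copyEdges H (φ e)}.ncard : ℝ)) := by
  have hm := mStar_pos_of_lt_xStar H (m2_pos hGne) hx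
  have hW2 : 2 ≤ Fintype.card W := by omega
  have hJ := one_le_jansonConst H (by omega)
  have he : (0 : ℝ) < H.edgeSet.ncard := by
    exact_mod_cast (Set.ncard_pos (Set.toFinite _)).2 hHne
  have hr : 0 < G.edgeSet.ncard := (Set.ncard_pos (Set.toFinite _)).2 hGne
  obtain ⟨ε, hε, n₁, hcopies⟩ := exists_many_copies G H
  obtain ⟨L, a, hL, ha, hcont⟩ := exists_coloring_containers G H hGne hε
  set K : ℕ := L * G.edgeSet.ncard with hK
  set cJ : ℝ := ε / (8 * jansonConst H) with hcJ
  have hcJ0 : 0 < cJ := by positivity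
  have hK0 : (0 : ℝ) < K := by exact_mod_cast Nat.mul_pos hL hr
  obtain ⟨lam, η, hlam₀, hlam₁, hη, hlam, hlog, hηe⟩ := exists_small_parameters hK0 hcJ0 hε he
  have hlog0 : 0 ≤ Real.log (1 / lam) := Real.log_nonneg ((one_le_div hlam₀).2 hlam₁)
  refine ⟨a * (η / 2) ^ G.edgeSet.ncard, cJ / 2, max 1 (2 / η), max n₁ 1, by positivity,
    by positivity, by positivity, by positivity, fun n hn p hp hpn => ?_⟩
  have hn0 : 0 < n := by omega
  have hn1 : (1 : ℝ) ≤ n := by exact_mod_cast hn0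
  have hnpos : (0 : ℝ) < n := by exact_mod_cast hn0
  have hp₀ : 0 ≤ p := le_trans (by positivity) hp
  have hp₁ : p ≤ 1 := hpn.trans (Real.rpow_le_one_of_one_le_of_nonpos hn1
    (neg_nonpos.2 (by positivity)))
  set q : ℝ := (n : ℝ) ^ (Fintype.card W - 2) * p ^ H.edgeSet.ncard with hq
  set s : ℝ := (n : ℝ) ^ (-(1 / m2 G)) with hs
  have hs0 : 0 < s := by positivity
  have hCq : max 1 (2 / η) * s ≤ q :=
    mul_rpow_le_pow_mul_pow G H hGne hHne hW2 hn1 (le_max_left _ _) hp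
  have hsq : 2 * s ≤ η * q := by
    have h := (mul_le_mul_of_nonneg_right (le_max_right 1 (2 / η)) hs0.le).trans hCq
    rw [div_mul_eq_mul_div, div_le_iff₀ hη] at h
    linarith
  have hq1 : q ≤ 1 := pow_mul_pow_le_one hHne hm hn1 hp₀ hp₁ hpn
  have hq0 : 0 < q := by nlinarith
  have hμ : (n : ℝ) ^ Fintype.card W * p ^ H.edgeSet.ncard = q * (n : ℝ) ^ 2 := by
    rw [hq, ← Nat.sub_add_cancel hW2, pow_add, Nat.add_sub_cancel]
    ring
  have hbig : 2 ≤ η * q * (n : ℝ) ^ 2 := by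
    have h1 := one_le_rpow_mul_sq hGne hn1
    have h2 := mul_le_mul_of_nonneg_right hsq (by positivity : (0 : ℝ) ≤ (n : ℝ) ^ 2)
    linarith
  set b : ℕ := ⌊η * q * (n : ℝ) ^ 2⌋₊ with hb
  have hb_le : (b : ℝ) ≤ η * q * (n : ℝ) ^ 2 := Nat.floor_le (by positivity)
  have hb_ge : η / 2 * q * (n : ℝ) ^ 2 ≤ b := by
    have := Nat.lt_floor_add_one (η * q * (n : ℝ) ^ 2)
    linarith
  have hθ : η / 2 * q ≤ b / (n : ℝ) ^ 2 := (le_div_iff₀ (by positivity)).2 hb_ge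
  obtain ⟨𝒵, hsum, hcard, hfew, hcov⟩ := hcont n (b / (n : ℝ) ^ 2) (p ^ H.edgeSet.ncard) b hn0
    (by linarith) (by positivity) (by field_simp)
  have hz : ∀ z ∈ 𝒵, ε * (n : ℝ) ^ Fintype.card W ≤
      ((Finset.univ.filter fun h : W ↪ Fin n =>
        ∀ e ∈ H.edgeSet, Sym2.map h e ∈ z.2).card : ℝ) := fun z hz𝒵 =>
    (hcopies n (by omega) z.2).resolve_left (hfew z hz𝒵).not_ge
  have hsmall : ∀ z ∈ 𝒵, (z.1.card : ℝ) * (4 * H.edgeSet.ncard ^ 2) ≤ ε / 2 * (n : ℝ) ^ 2 := by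
    intro z hz𝒵
    have h1 : (z.1.card : ℝ) ≤ K * b := by exact_mod_cast hcard z hz𝒵
    have h2 : (b : ℝ) ≤ η * (n : ℝ) ^ 2 := by
      refine hb_le.trans (mul_le_mul_of_nonneg_right ?_ (by positivity))
      exact mul_le_of_le_one_right hη.le hq1
    calc (z.1.card : ℝ) * (4 * H.edgeSet.ncard ^ 2)
        ≤ K * (η * (n : ℝ) ^ 2) * (4 * H.edgeSet.ncard ^ 2) := by
          gcongr
          exact h1.trans (by gcongr)
      _ = K * η * (4 * H.edgeSet.ncard ^ 2) * (n : ℝ) ^ 2 := by ring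
      _ ≤ _ := by gcongr
  refine one_sub_le_gnpProb ?_
  calc expect (pairs n) p _
      ≤ expect (pairs n) p (fun S => if ∃ z ∈ 𝒵, Consistent z S then 1 else 0) := by
        refine expect_mono hp₀ hp₁ fun S _ => ?_
        by_cases hS : ∃ z ∈ 𝒵, Consistent z S
        · rw [if_pos hS]
          split_ifs <;> norm_num
        · rw [if_neg hS, if_pos]
          intro c hblue
          by_contra! hlt
          refine hS (hcov S c hblue (lt_of_lt_of_le hlt ?_))
          calc a * (η / 2) ^ G.edgeSet.ncard * (n : ℝ) ^ Fintype.card V * q ^ G.edgeSet.ncard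
              = a * (η / 2 * q) ^ G.edgeSet.ncard * (n : ℝ) ^ Fintype.card V := by
                rw [mul_pow]
                ring
            _ ≤ _ := by gcongr
    _ ≤ (∑ z ∈ 𝒵, (p ^ H.edgeSet.ncard) ^ z.1.card) *
          Real.exp (-(cJ * ((n : ℝ) ^ Fintype.card W * p ^ H.edgeSet.ncard))) :=
        expect_exists_consistent_le hm hn0 hW2 hp₀ hp₁ hpn 𝒵 hz hsmall
    _ ≤ smallSetSum ((W ↪ Fin n) × H.edgeSet) (p ^ H.edgeSet.ncard) b ^ K *
          Real.exp (-(cJ * ((n : ℝ) ^ Fintype.card W * p ^ H.edgeSet.ncard))) := by gcongr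
    _ ≤ Real.exp (-(cJ / 2 * ((n : ℝ) ^ Fintype.card W * p ^ H.edgeSet.ncard))) := by
        refine smallSetSum_pow_mul_exp_le (e := H.edgeSet.ncard) (by positivity) hlam₀ hlam₁
          (by positivity) ?_ hlam ?_
        · rw [← mul_assoc]
          exact mul_le_mul_of_nonneg_right (card_rooted_le H n) (by positivity)
        · rw [hμ]
          calc (K : ℝ) * (b * Real.log (1 / lam))
              ≤ K * (η * q * (n : ℝ) ^ 2 * Real.log (1 / lam)) := by gcongr
            _ = K * (η * Real.log (1 / lam)) * (q * (n : ℝ) ^ 2) := by ring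
            _ ≤ _ := by gcongr
    _ ≤ _ := by
        rw [mul_assoc (cJ / 2)]
        exact exp_neg_le_two_rpow_neg (by positivity)

end AsymRamsey
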